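/- Let A ⊂ ℝ^N be a finite set of n+k+1 vectors (real exponent vectors) whose affine span has dimension n (with n ≥ 1, k ≥ 0), and let f : ℝ^N_> → ℝ be a signomial f(x) = Σ_{a ∈ A} c_a · x_1^{a_1} ⋯ x_N^{a_N} with all coefficients c_a nonzero. Suppose the zero set X = {x ∈ ℝ^N_> : f(x) = 0} is a smooth hypersurface, i.e., the derivative of f is nonzero at every point of X. Then X has fewer than ((e² + 3)/4) · 2^(k(k+1)/2) · 2^n · n^(k+1) connected components; in particular the number of connected components of X is finite. -/

import Mathlib

/-- The set of connected components of a subset `X` of `ℝ^N`, as subsets of `ℝ^N`. -/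
def components {N : ℕ} (X : Set (Fin N → ℝ)) : Set (Set (Fin N → ℝ)) :=
  {C | ∃ x ∈ X, C = connectedComponentIn X x}

section

open Set Filter Topology

section Fibre

variable {X : Type*} [TopologicalSpace X] {ψ : X → ℝ}

lemma finite_fibre_of_locally_injective [CompactSpace X] (hψ : Continuous ψ)
    (hinj : ∀ x, ∃ U ∈ 𝓝 x, InjOn ψ U) (τ : ℝ) : (ψ ⁻¹' {τ}).Finite := by
  have hc : IsCompact (ψ ⁻¹' {τ}) := (isClosed_singleton.preimage hψ).isCompact
  choose U hU hUi using hinj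
  obtain ⟨s, hs, hcov⟩ := hc.elim_nhds_subcover U (fun x _ => hU x)
  refine Set.Finite.subset (s.finite_toSet.biUnion (t := fun x => U x ∩ ψ ⁻¹' {τ})
    fun x _ => ?_) (fun y hy => ?_)
  · refine Set.Subsingleton.finite fun a ha b hb => hUi x ha.1 hb.1 ?_
    rw [show ψ a = τ from ha.2, show ψ b = τ from hb.2]
  · obtain ⟨x, hx, hyx⟩ := mem_iUnion₂.1 (hcov hy)
    exact mem_iUnion₂.2 ⟨x, hx, hyx, hy⟩

lemma eventually_ncard_fibre_le [CompactSpace X] (hψ : Continuous ψ)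
    (hinj : ∀ x, ∃ U ∈ 𝓝 x, InjOn ψ U) (τ₀ : ℝ) :
    ∀ᶠ τ in 𝓝 τ₀, (ψ ⁻¹' {τ}).ncard ≤ (ψ ⁻¹' {τ₀}).ncard := by
  have hfin := finite_fibre_of_locally_injective hψ hinj
  choose U hU hUi using hinj
  set W : Set X := ⋃ x ∈ ψ ⁻¹' {τ₀}, interior (U x)
  have hW : IsOpen W := isOpen_biUnion fun x _ => isOpen_interior
  have hcl : IsClosed (ψ '' Wᶜ) := (hW.isClosed_compl.isCompact.image hψ).isClosed
  have hτ : τ₀ ∉ ψ '' Wᶜ := by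
    rintro ⟨x, hx, hxτ⟩
    exact hx (mem_iUnion₂.2 ⟨x, hxτ, mem_interior_iff_mem_nhds.2 (hU x)⟩)
  filter_upwards [hcl.isOpen_compl.mem_nhds hτ] with τ hτ
  have hmem : ∀ y : X, ψ y = τ → ∃ x, ψ x = τ₀ ∧ y ∈ U x := by
    intro y hy
    by_contra! hcon
    refine hτ ⟨y, fun hyW => ?_, hy⟩
    obtain ⟨x, hx, hyx⟩ := mem_iUnion₂.1 hyW
    exact hcon x hx (interior_subset hyx)
  choose! g hg hgU using hmem
  refine ncard_le_ncard_of_injOn g (fun y hy => hg y hy) (fun a ha b hb hab => ?_) (hfin τ₀)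
  have h1 := hgU a ha
  rw [hab] at h1
  refine hUi _ h1 (hgU b hb) ?_
  rw [show ψ a = τ from ha, show ψ b = τ from hb]

lemma eventually_ncard_fibre_ge [CompactSpace X] [T2Space X] (hψ : Continuous ψ)
    (hinj : ∀ x, ∃ U ∈ 𝓝 x, InjOn ψ U) {B : Set X}
    (hopen : ∀ x ∉ B, 𝓝 (ψ x) ≤ map ψ (𝓝 x)) (τ₀ : ℝ) :
    ∀ᶠ τ in 𝓝 τ₀, (ψ ⁻¹' {τ₀} \ B).ncard ≤ (ψ ⁻¹' {τ}).ncard := by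
  have hfin := finite_fibre_of_locally_injective hψ hinj
  obtain ⟨V, hV, hVd⟩ := (hfin τ₀).t2_separation
  have hev : ∀ᶠ τ in 𝓝 τ₀, ∀ x ∈ ψ ⁻¹' {τ₀} \ B, ∃ y ∈ V x, ψ y = τ := by
    refine (eventually_all_finite ((hfin τ₀).subset sdiff_subset)).2 fun x hx => ?_
    have h1 : ψ '' V x ∈ 𝓝 τ₀ := by
      have := hopen x hx.2 (image_mem_map ((hV x).2.mem_nhds (hV x).1))
      rwa [show ψ x = τ₀ from hx.1] at this
    filter_upwards [h1] with τ hτ using hτ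
  filter_upwards [hev] with τ hτ
  choose! g hgV hg using hτ
  refine ncard_le_ncard_of_injOn g (fun x hx => hg x hx) (fun a ha b hb hab => ?_) (hfin τ)
  by_contra hne
  have := hVd ha.1 hb.1 hne
  exact Set.disjoint_left.1 this (hgV a ha) (hab ▸ hgV b hb)

lemma ncard_fibre_diff_le_ncard_pos [CompactSpace X] [T2Space X] (hψ : Continuous ψ)
    (hinj : ∀ x, ∃ U ∈ 𝓝 x, InjOn ψ U) {B : Set X} (hB : B.Finite)
    (hopen : ∀ x ∉ B, 𝓝 (ψ x) ≤ map ψ (𝓝 x)) :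
    (ψ ⁻¹' {0} \ B).ncard ≤ (B ∩ {x | 0 < ψ x}).ncard := by
  have hfin := finite_fibre_of_locally_injective hψ hinj
  set M := (ψ ⁻¹' {0} \ B).ncard
  set Bad : Set ℝ := {τ | 0 < τ ∧ (ψ ⁻¹' {τ}).ncard + (B ∩ {x | 0 < ψ x ∧ ψ x < τ}).ncard < M}
  have hsub : ∀ S : Set X, (B ∩ S).Finite := fun S => hB.subset inter_subset_left
  by_cases hne : Bad.Nonempty
  · exfalso
    have hbdd : BddBelow Bad := ⟨0, fun τ h => h.1.le⟩
    set τ₀ := sInf Bad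
    have h0 : 0 ≤ τ₀ := le_csInf hne fun τ h => h.1.le
    have hgood : ∀ σ, 0 < σ → σ < τ₀ →
        M ≤ (ψ ⁻¹' {σ}).ncard + (B ∩ {x | 0 < ψ x ∧ ψ x < σ}).ncard := by
      intro σ h1 h2
      by_contra! h
      exact (csInf_le hbdd ⟨h1, h⟩).not_gt h2
    have hright : ∃ᶠ τ in 𝓝 τ₀, τ ∈ Bad :=
      mem_closure_iff_frequently.1 (csInf_mem_closure hne hbdd)
    have hge := eventually_ncard_fibre_ge hψ hinj hopen τ₀
    rcases h0.eq_or_lt with h0 | h0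
    · rw [← h0] at hge hright
      obtain ⟨τ, hτ, hle⟩ := (hright.and_eventually hge).exists
      exact absurd hτ.2 (by omega)
    · have hgood0 : M ≤ (ψ ⁻¹' {τ₀}).ncard + (B ∩ {x | 0 < ψ x ∧ ψ x < τ₀}).ncard := by
        have h1 : ∃ᶠ σ in 𝓝 τ₀, σ < τ₀ := by
          have : τ₀ ∈ closure (Iio τ₀) := by simp
          exact mem_closure_iff_frequently.1 this
        obtain ⟨σ, ⟨hσ1, hσ3⟩, hσ2⟩ := ((h1.and_eventually (lt_mem_nhds h0)).and_eventually
          (eventually_ncard_fibre_le hψ hinj τ₀)).exists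
        refine (hgood σ hσ3 hσ1).trans (add_le_add hσ2 (ncard_le_ncard ?_ (hsub _)))
        exact fun x hx => ⟨hx.1, hx.2.1, hx.2.2.trans hσ1⟩
      obtain ⟨τ, hτ, hle⟩ := (hright.and_eventually hge).exists
      have hττ : τ₀ ≤ τ := csInf_le hbdd hτ
      rcases hττ.eq_or_lt with h | h
      · have := hτ.2
        rw [← h] at this
        omega
      · have e1 : (ψ ⁻¹' {τ₀}).ncard ≤ (ψ ⁻¹' {τ₀} \ B).ncard + (ψ ⁻¹' {τ₀} ∩ B).ncard := by
          rw [add_comm, ncard_inter_add_ncard_sdiff_eq_ncard _ _ (hfin _)]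
        have e2 : (B ∩ {x | 0 < ψ x ∧ ψ x < τ₀}).ncard + (ψ ⁻¹' {τ₀} ∩ B).ncard ≤
            (B ∩ {x | 0 < ψ x ∧ ψ x < τ}).ncard := by
          rw [← ncard_union_eq _ (hsub _) (hB.subset inter_subset_right)]
          · refine ncard_le_ncard ?_ (hsub _)
            rintro x (hx | hx)
            · exact ⟨hx.1, hx.2.1, hx.2.2.trans h⟩
            · have : ψ x = τ₀ := hx.1
              exact ⟨hx.2, by simp [this, h0], by simp [this, h]⟩
          · refine Set.disjoint_left.2 fun x hx hx' => ?_
            have : ψ x = τ₀ := hx'.1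
            exact absurd hx.2.2 (by simp [this])
        have := hτ.2
        omega
  · obtain ⟨b, hb⟩ := (isCompact_univ.image hψ).bddAbove
    set τ := max b 0 + 1
    have hτ : τ ∉ Bad := fun h => hne ⟨τ, h⟩
    have hτ0 : 0 < τ := by positivity
    have hempty : ψ ⁻¹' {τ} = ∅ := by
      ext x
      have : ψ x ≤ b := hb ⟨x, trivial, rfl⟩
      have h2 : b < τ := by
        have := le_max_left b 0
        simp only [τ]; linarith
      simp only [mem_preimage, mem_singleton_iff, mem_empty_iff_false, iff_false]
      intro h; linarith
    have h1 : ¬ _ := fun h => hτ ⟨hτ0, h⟩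
    rw [hempty, ncard_empty, zero_add, not_lt] at h1
    exact h1.trans (ncard_le_ncard (fun x hx => ⟨hx.1, hx.2.1⟩) (hsub _))

/-- A Rolle-type count: if a real function on a compact space is locally injective, and open
outside a finite set `B`, then it has at most `#B / 2` zeros outside `B`. -/
lemma two_mul_ncard_fibre_diff_le [CompactSpace X] [T2Space X] (hψ : Continuous ψ)
    (hinj : ∀ x, ∃ U ∈ 𝓝 x, InjOn ψ U) {B : Set X} (hB : B.Finite)
    (hopen : ∀ x ∉ B, 𝓝 (ψ x) ≤ map ψ (𝓝 x)) :
    2 * (ψ ⁻¹' {0} \ B).ncard ≤ B.ncard := by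
  have h1 := ncard_fibre_diff_le_ncard_pos hψ hinj hB hopen
  have h2 := ncard_fibre_diff_le_ncard_pos (ψ := fun x => -ψ x) hψ.neg
    (fun x => (hinj x).imp fun U hU => ⟨hU.1, fun a ha b hb hab => hU.2 ha hb (neg_injective hab)⟩)
    hB (fun x hx => by
      have := map_mono (m := Neg.neg) (hopen x hx)
      rw [map_map] at this
      refine le_trans ?_ this
      exact ((Homeomorph.neg ℝ).map_nhds_eq (ψ x)).ge)
  have e : (fun x => -ψ x) ⁻¹' {0} = ψ ⁻¹' {0} := by ext; simp
  rw [e] at h2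
  have h3 : (B ∩ {x | 0 < ψ x}).ncard + (B ∩ {x | 0 < -ψ x}).ncard ≤ B.ncard := by
    rw [← ncard_union_eq _ (hB.subset inter_subset_left) (hB.subset inter_subset_left)]
    · exact ncard_le_ncard (union_subset inter_subset_left inter_subset_left) hB
    · refine Set.disjoint_left.2 fun x hx hx' => ?_
      have h1 : 0 < ψ x := hx.2
      have h2 : 0 < -ψ x := hx'.2
      linarith
  omega

end Fibre

end

section

open Set Filter Topology MvPolynomial

/-- One equation of a mixed system on `ℝ^ι`: an affine-linear equation in `t`, the equation
`t a = c`, or a polynomial equation in `exp t`. -/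
inductive ExpEqn (ι : Type*)
  | lin (w : ι → ℝ) (c : ℝ)
  | coord (a : ι) (c : ℝ)
  | poly (P : MvPolynomial ι ℝ)

namespace ExpEqn

variable {ι : Type*} [Fintype ι] [DecidableEq ι]

/-- The function whose vanishing is the equation. -/
noncomputable def val : ExpEqn ι → (ι → ℝ) → ℝ
  | lin w c, t => ∑ a, w a * t a - c
  | coord a c, t => t a - c
  | poly P, t => eval (fun a => Real.exp (t a)) P

/-- The gradient, as a vector of polynomials in `exp t`. -/
noncomputable def grad : ExpEqn ι → ι → MvPolynomial ι ℝ
  | lin w _, a => C (w a)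
  | coord b _, a => if a = b then 1 else 0
  | poly P, a => X a * pderiv a P

/-- A bound for the degrees of the entries of the gradient. -/
def gradDegree : ExpEqn ι → ℕ
  | lin _ _ => 0
  | coord _ _ => 0
  | poly P => P.totalDegree

/-- The contribution of an equation to the Bézout number. -/
def bezoutDegree : ExpEqn ι → ℕ
  | lin _ _ => 1
  | coord _ _ => 1
  | poly P => P.totalDegree

/-- The equation is of the affine-linear type. -/
def IsLin : ExpEqn ι → Prop
  | lin _ _ => True
  | _ => False

/-- The equation `e = c`. -/
noncomputable def shift : ExpEqn ι → ℝ → ExpEqn ι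
  | lin w c, d => lin w (c + d)
  | coord a c, d => coord a (c + d)
  | poly P, d => poly (P - C d)

/-- The derivative of `e.val` at `t`. -/
noncomputable def deriv (e : ExpEqn ι) (t : ι → ℝ) : (ι → ℝ) →L[ℝ] ℝ :=
  ∑ a, eval (fun b => Real.exp (t b)) (e.grad a) • ContinuousLinearMap.proj a

lemma deriv_apply (e : ExpEqn ι) (t v : ι → ℝ) :
    e.deriv t v = ∑ a, eval (fun b => Real.exp (t b)) (e.grad a) * v a := by
  simp [deriv]

lemma hasStrictFDerivAt_poly (P : MvPolynomial ι ℝ) (t : ι → ℝ) :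
    HasStrictFDerivAt (poly P).val ((poly P).deriv t) t := by
  have hz : ∀ a : ι, HasStrictFDerivAt (fun t : ι → ℝ => Real.exp (t a))
      (Real.exp (t a) • (ContinuousLinearMap.proj a : (ι → ℝ) →L[ℝ] ℝ)) t := fun a =>
    (ContinuousLinearMap.proj a : (ι → ℝ) →L[ℝ] ℝ).hasStrictFDerivAt.exp
  induction P using MvPolynomial.induction_on with
  | C r =>
    have : (poly (C r) : ExpEqn ι).val = fun _ => r := by ext; simp [val]
    rw [this]
    refine (hasStrictFDerivAt_const r t).congr_fderiv ?_
    ext v; simp [deriv_apply, grad]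
  | add p q hp hq =>
    have : (poly (p + q) : ExpEqn ι).val = fun t => (poly p).val t + (poly q).val t := by
      ext; simp [val]
    rw [this]
    refine (hp.fun_add hq).congr_fderiv ?_
    ext v; simp [deriv_apply, grad, mul_add, add_mul, Finset.sum_add_distrib]
  | mul_X p b hp =>
    have : (poly (p * X b) : ExpEqn ι).val = fun t => (poly p).val t * Real.exp (t b) := by
      ext; simp [val]
    rw [this]
    refine (hp.fun_mul (hz b)).congr_fderiv ?_
    ext v
    simp only [deriv_apply, grad, Derivation.leibniz, pderiv_X, smul_eq_mul, map_mul, eval_X,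
      map_add, add_apply, smul_apply, val, mul_add,
      add_mul, Finset.sum_add_distrib, ContinuousLinearMap.proj_apply, Finset.mul_sum]
    congr 1
    · rw [Finset.sum_eq_single b]
      · simp; ring
      · intro a _ hab
        simp [hab.symm]
      · simp
    · exact Finset.sum_congr rfl fun a _ => by ring

lemma hasStrictFDerivAt_val (e : ExpEqn ι) (t : ι → ℝ) :
    HasStrictFDerivAt e.val (e.deriv t) t := by
  rcases e with ⟨w, c⟩ | ⟨a, c⟩ | P
  · have : HasStrictFDerivAt (fun t : ι → ℝ => ∑ a, w a * t a - c)
        (∑ a, w a • (ContinuousLinearMap.proj a : (ι → ℝ) →L[ℝ] ℝ)) t := by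
      refine HasStrictFDerivAt.sub_const _ (HasStrictFDerivAt.fun_sum fun a _ => ?_)
      exact (ContinuousLinearMap.proj a : (ι → ℝ) →L[ℝ] ℝ).hasStrictFDerivAt.const_mul _
    refine this.congr_fderiv ?_
    ext v; simp [deriv_apply, grad]
  · have : HasStrictFDerivAt (fun t : ι → ℝ => t a - c)
        (ContinuousLinearMap.proj a : (ι → ℝ) →L[ℝ] ℝ) t :=
      HasStrictFDerivAt.sub_const _
        (ContinuousLinearMap.proj a : (ι → ℝ) →L[ℝ] ℝ).hasStrictFDerivAt
    refine this.congr_fderiv ?_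
    ext v; simp [deriv_apply, grad, apply_ite (eval _)]
  · exact hasStrictFDerivAt_poly P t

lemma continuous_val (e : ExpEqn ι) : Continuous e.val :=
  continuous_iff_continuousAt.2 fun t => (e.hasStrictFDerivAt_val t).continuousAt

omit [DecidableEq ι] in
lemma val_shift (e : ExpEqn ι) (c : ℝ) (t : ι → ℝ) : (e.shift c).val t = e.val t - c := by
  rcases e with ⟨w, c⟩ | ⟨a, c⟩ | P <;> simp [val, shift] <;> ring

omit [Fintype ι] in
lemma grad_shift (e : ExpEqn ι) (c : ℝ) : (e.shift c).grad = e.grad := by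
  rcases e with ⟨w, c⟩ | ⟨a, c⟩ | P <;> ext1 a <;> simp [grad, shift]

omit [Fintype ι] [DecidableEq ι] in
lemma totalDegree_sub_C_le (P : MvPolynomial ι ℝ) (c : ℝ) :
    (P - C c).totalDegree ≤ P.totalDegree :=
  (totalDegree_sub _ _).trans (by simp)

omit [Fintype ι] [DecidableEq ι] in
lemma gradDegree_shift_le (e : ExpEqn ι) (c : ℝ) : (e.shift c).gradDegree ≤ e.gradDegree := by
  rcases e with ⟨w, c⟩ | ⟨a, c⟩ | P <;> simp [gradDegree, shift, totalDegree_sub_C_le]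

omit [Fintype ι] [DecidableEq ι] in
lemma bezoutDegree_shift_le (e : ExpEqn ι) (c : ℝ) :
    (e.shift c).bezoutDegree ≤ e.bezoutDegree := by
  rcases e with ⟨w, c⟩ | ⟨a, c⟩ | P <;> simp [bezoutDegree, shift, totalDegree_sub_C_le]

omit [Fintype ι] [DecidableEq ι] in
lemma isLin_shift (e : ExpEqn ι) (c : ℝ) : (e.shift c).IsLin ↔ e.IsLin := by
  rcases e with ⟨w, c⟩ | ⟨a, c⟩ | P <;> simp [IsLin, shift]

omit [Fintype ι] [DecidableEq ι] in
lemma totalDegree_X_mul_pderiv_le (P : MvPolynomial ι ℝ) (a : ι) :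
    (X a * pderiv a P).totalDegree ≤ P.totalDegree := by
  have h : X a * pderiv a P = ∑ m ∈ P.support, (m a : ℝ) • monomial m (coeff m P) := by
    conv_lhs => rw [P.as_sum]
    rw [map_sum, Finset.mul_sum]
    refine Finset.sum_congr rfl fun m _ => ?_
    rw [X_mul_pderiv_monomial, Nat.cast_smul_eq_nsmul]
  rw [h]
  refine totalDegree_finsetSum_le fun m hm => (totalDegree_smul_le _ _).trans ?_
  exact (totalDegree_monomial_le _ _).trans (le_totalDegree hm)

omit [Fintype ι] in
lemma totalDegree_grad_le (e : ExpEqn ι) (a : ι) : (e.grad a).totalDegree ≤ e.gradDegree := by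
  rcases e with ⟨w, c⟩ | ⟨b, c⟩ | P
  · simp [grad]
  · simp only [grad]; split_ifs <;> simp
  · exact totalDegree_X_mul_pderiv_le P a

section System

variable (e : ι → ExpEqn ι)

/-- The Jacobian determinant of a square system, as a polynomial in `exp t`. -/
noncomputable def jac : MvPolynomial ι ℝ := (Matrix.of fun i a => (e i).grad a).det

/-- The map defined by a system. -/
noncomputable def map (t : ι → ℝ) : ι → ℝ := fun i => (e i).val t

/-- The derivative of `map e`. -/
noncomputable def mapDeriv (t : ι → ℝ) : (ι → ℝ) →L[ℝ] (ι → ℝ) :=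
  ContinuousLinearMap.pi fun i => (e i).deriv t

/-- The nondegenerate solutions of a system. -/
def regularZeros : Set (ι → ℝ) := {t | map e t = 0 ∧ (poly (jac e)).val t ≠ 0}

lemma totalDegree_jac_le : (jac e).totalDegree ≤ ∑ i, (e i).gradDegree := by
  rw [jac, Matrix.det_apply]
  refine totalDegree_finsetSum_le fun σ _ => (totalDegree_smul_le _ _).trans ?_
  refine (totalDegree_finsetProd _ _).trans ?_
  rw [← Equiv.sum_comp σ fun i => (e i).gradDegree]
  exact Finset.sum_le_sum fun i _ => totalDegree_grad_le _ _

lemma hasStrictFDerivAt_map (t : ι → ℝ) : HasStrictFDerivAt (map e) (mapDeriv e t) t :=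
  hasStrictFDerivAt_pi.2 fun i => (e i).hasStrictFDerivAt_val t

lemma det_mapDeriv (t : ι → ℝ) : (mapDeriv e t).det = (poly (jac e)).val t := by
  have h : (mapDeriv e t : (ι → ℝ) →ₗ[ℝ] (ι → ℝ)) = Matrix.toLin'
      ((Matrix.of fun i a => (e i).grad a).map (eval fun b => Real.exp (t b))) := by
    ext v i
    simp [mapDeriv, deriv_apply, Matrix.toLin'_apply, Matrix.mulVec, dotProduct]
  rw [ContinuousLinearMap.det, h, LinearMap.det_toLin', val, jac, RingHom.map_det]
  rfl

lemma val_jac_ne_zero_iff (t : ι → ℝ) :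
    (poly (jac e)).val t ≠ 0 ↔ ∀ v, (∀ i, (e i).deriv t v = 0) → v = 0 := by
  rw [← det_mapDeriv, ContinuousLinearMap.det, ← isUnit_iff_ne_zero,
    ← LinearMap.isUnit_iff_isUnit_det, LinearMap.isUnit_iff_ker_eq_bot, LinearMap.ker_eq_bot']
  refine forall_congr' fun v => ?_
  simp [mapDeriv, funext_iff]

lemma map_nhds_eq {t : ι → ℝ} (ht : (poly (jac e)).val t ≠ 0) :
    Filter.map (map e) (𝓝 t) = 𝓝 (map e t) := by
  refine (hasStrictFDerivAt_map e t).map_nhds_eq_of_surj ?_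
  rw [← det_mapDeriv, ContinuousLinearMap.det, ← isUnit_iff_ne_zero,
    ← LinearMap.isUnit_iff_isUnit_det, LinearMap.isUnit_iff_range_eq_top] at ht
  exact ht

lemma exists_injOn_nhds {t : ι → ℝ} (ht : (poly (jac e)).val t ≠ 0) :
    ∃ U ∈ 𝓝 t, InjOn (map e) U := by
  rw [← det_mapDeriv] at ht
  set L := (mapDeriv e t).toContinuousLinearEquivOfDetNeZero ht
  have h : HasStrictFDerivAt (map e) (L : (ι → ℝ) →L[ℝ] (ι → ℝ)) t := by
    simpa [L] using hasStrictFDerivAt_map e t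
  refine ⟨(h.toOpenPartialHomeomorph (map e)).source,
    (h.toOpenPartialHomeomorph (map e)).open_source.mem_nhds
      h.mem_toOpenPartialHomeomorph_source, ?_⟩
  exact (h.toOpenPartialHomeomorph (map e)).injOn

/-- Sard's theorem: almost every value of a system is regular. -/
lemma ae_forall_val_jac_ne_zero :
    ∀ᵐ c ∂(MeasureTheory.volume : MeasureTheory.Measure (ι → ℝ)),
      ∀ t, map e t = c → (poly (jac e)).val t ≠ 0 := by
  have h := MeasureTheory.addHaar_image_eq_zero_of_det_fderivWithin_eq_zero
    (MeasureTheory.volume : MeasureTheory.Measure (ι → ℝ)) (f := map e)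
    (s := {t | (poly (jac e)).val t = 0})
    (fun t _ => (hasStrictFDerivAt_map e t).hasFDerivAt.hasFDerivWithinAt)
    (fun t ht => by rw [det_mapDeriv]; exact ht)
  filter_upwards [MeasureTheory.measure_eq_zero_iff_ae_notMem.1 h] with c hc t ht h0
  exact hc ⟨t, h0, ht⟩

end System

end ExpEqn

end

section

open Set Filter Topology MvPolynomial

section Counting

variable {ι : Type*} [Fintype ι] [DecidableEq ι]

/-- Exponent vectors of weighted degree at most `M`. -/
def weightedExponents (d : ι → ℕ) (M : ℕ) : Finset (ι → ℕ) :=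
  (Fintype.piFinset fun _ => Finset.range (M + 1)).filter fun α => ∑ i, d i * α i ≤ M

lemma mem_weightedExponents {d : ι → ℕ} (hd : ∀ i, 1 ≤ d i) {M : ℕ} {α : ι → ℕ} :
    α ∈ weightedExponents d M ↔ ∑ i, d i * α i ≤ M := by
  simp only [weightedExponents, Finset.mem_filter, Fintype.mem_piFinset, Finset.mem_range,
    and_iff_right_iff_imp]
  intro h i
  have h1 : d i * α i ≤ ∑ i, d i * α i :=
    Finset.single_le_sum (f := fun i => d i * α i) (fun _ _ => Nat.zero_le _) (Finset.mem_univ i)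
  have h2 := Nat.le_mul_of_pos_left (α i) (hd i)
  omega

lemma card_weightedExponents_le (d : ι → ℕ) (M : ℕ) :
    (weightedExponents d M).card ≤ (M + 1) ^ Fintype.card ι := by
  refine (Finset.card_filter_le _ _).trans ?_
  simp [Fintype.card_piFinset]

lemma card_weightedExponents_one_le {d : ι → ℕ} (hd : ∀ i, 1 ≤ d i) (M : ℕ) :
    (weightedExponents (1 : ι → ℕ) M).card ≤ (∏ i, d i) * (weightedExponents d M).card := by
  have hf : ∀ β ∈ weightedExponents (1 : ι → ℕ) M,
      ((fun i => β i % d i), fun i => β i / d i) ∈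
        (Fintype.piFinset fun i => Finset.range (d i)) ×ˢ weightedExponents d M := by
    intro β hβ
    rw [mem_weightedExponents (by simp)] at hβ
    rw [Finset.mem_product, mem_weightedExponents hd, Fintype.mem_piFinset]
    refine ⟨fun i => Finset.mem_range.2 (Nat.mod_lt _ (hd i)), le_trans ?_ hβ⟩
    refine Finset.sum_le_sum fun i _ => ?_
    simpa using Nat.mul_div_le (β i) (d i)
  refine (Finset.card_le_card_of_injOn _ hf ?_).trans ?_
  · intro β _ β' _ h
    simp only [Prod.mk.injEq, funext_iff] at h
    ext i
    rw [← Nat.mod_add_div (β i) (d i), ← Nat.mod_add_div (β' i) (d i), h.1 i, h.2 i]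
  · simp [Fintype.card_piFinset]

lemma exists_mul_card_weightedExponents_lt (D : ℕ) (hD : 1 ≤ D) :
    ∃ M, D * (weightedExponents (1 : ι → ℕ) (M + D)).card
      < (D + 1) * (weightedExponents (1 : ι → ℕ) M).card := by
  by_contra! h
  set a : ℕ → ℝ := fun m => (weightedExponents (1 : ι → ℕ) (m * D)).card with ha
  set r : ℝ := 1 + 1 / D with hr
  have hD' : (0 : ℝ) < D := by exact_mod_cast hD
  have hr1 : 1 < r := by rw [hr]; have : 0 < 1 / (D : ℝ) := by positivity
                         linarith
  have hstep : ∀ m, r * a m ≤ a (m + 1) := by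
    intro m
    have h1 : ((D + 1 : ℕ) : ℝ) * a m ≤ D * a (m + 1) := by
      have := h (m * D)
      simp only [ha]
      rw [show (m + 1) * D = m * D + D by ring]
      exact_mod_cast this
    push_cast at h1
    rw [hr, show (1 + 1 / (D : ℝ)) * a m = (D + 1) * a m / D by field_simp, div_le_iff₀ hD']
    linarith
  have hgrow : ∀ m, r ^ m ≤ a m := by
    intro m
    induction m with
    | zero =>
      simp only [pow_zero, ha, zero_mul, Nat.one_le_cast, Finset.one_le_card]
      exact ⟨0, by rw [mem_weightedExponents (by simp)]; simp⟩
    | succ m ih =>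
      rw [pow_succ']
      exact (mul_le_mul_of_nonneg_left ih (by linarith)).trans (hstep m)
  have hupper : ∀ m, a m ≤ ((m : ℝ) * D + 1) ^ Fintype.card ι := by
    intro m
    simp only [ha]
    exact_mod_cast card_weightedExponents_le (1 : ι → ℕ) (m * D)
  have hlim := tendsto_pow_const_div_const_pow_of_one_lt (Fintype.card ι) hr1
  have hE : (0 : ℝ) < 1 / ((2 * D) ^ Fintype.card ι) := by positivity
  obtain ⟨m, hm, hm1⟩ := ((hlim.eventually (gt_mem_nhds hE)).and (eventually_ge_atTop 1)).exists
  have hrm : 0 < r ^ m := by positivity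
  rw [div_lt_div_iff₀ hrm (by positivity), one_mul, ← mul_pow] at hm
  have h3 : (m : ℝ) * D + 1 ≤ m * (2 * D) := by
    have : (1 : ℝ) ≤ m * D := by exact_mod_cast Nat.mul_pos hm1 hD
    linarith
  have h4 := (hgrow m).trans ((hupper m).trans
    (pow_le_pow_left₀ (by positivity) h3 (Fintype.card ι)))
  linarith

end Counting

section Relation

variable {ι : Type*} [Fintype ι] [DecidableEq ι]

/-- Among `card ι + 1` polynomials in `card ι` variables there is an algebraic relation, of
degree in the last one at most the product of the degrees of the others if that last one is
linear. -/
lemma exists_algebraic_relation (Q : ι → MvPolynomial ι ℝ) (d : ι → ℕ) (hd : ∀ i, 1 ≤ d i)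
    (hQ : ∀ i, (Q i).totalDegree ≤ d i) (ℓ : MvPolynomial ι ℝ) (hℓ : ℓ.totalDegree ≤ 1) :
    ∃ p : ℕ → MvPolynomial ι ℝ, (∃ j ≤ ∏ i, d i, p j ≠ 0) ∧
      ∑ j ∈ Finset.range (∏ i, d i + 1), bind₁ Q (p j) * ℓ ^ j = 0 := by
  set D := ∏ i, d i with hDdef
  have hD : 1 ≤ D := Finset.one_le_prod' fun i _ => hd i
  obtain ⟨M, hM⟩ := exists_mul_card_weightedExponents_lt (ι := ι) D hD
  set W := weightedExponents d M
  set V := weightedExponents (1 : ι → ℕ) (M + D)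
  have hcard : V.card < W.card * (D + 1) := by
    have h1 := card_weightedExponents_one_le hd M
    have h2 : D * V.card < D * (W.card * (D + 1)) := by
      calc D * V.card < (D + 1) * (weightedExponents (1 : ι → ℕ) M).card := hM
        _ ≤ (D + 1) * (D * W.card) := Nat.mul_le_mul_left _ h1
        _ = _ := by ring
    exact lt_of_mul_lt_mul_left h2 (Nat.zero_le _)
  let q : (W × Fin (D + 1) → ℝ) →ₗ[ℝ] MvPolynomial ι ℝ :=
    Fintype.linearCombination ℝ fun w : W × Fin (D + 1) =>
      (∏ i, Q i ^ (w.1 : ι → ℕ) i) * ℓ ^ (w.2 : ℕ)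
  let F : (W × Fin (D + 1) → ℝ) →ₗ[ℝ] (V → ℝ) :=
    LinearMap.pi fun β : V => (lcoeff ℝ (Finsupp.equivFunOnFinite.symm (β : ι → ℕ))) ∘ₗ q
  have hker : LinearMap.ker F ≠ ⊥ := LinearMap.ker_ne_bot_of_finrank_lt (by simpa using hcard)
  obtain ⟨x, hx, hx0⟩ := (Submodule.ne_bot_iff _).1 hker
  have hdeg : (q x).totalDegree ≤ M + D := by
    simp only [q, Fintype.linearCombination_apply]
    refine totalDegree_finsetSum_le fun w _ => (totalDegree_smul_le _ _).trans ?_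
    refine (totalDegree_mul _ _).trans (add_le_add ?_ ?_)
    · refine (totalDegree_finsetProd _ _).trans (le_trans ?_ ((mem_weightedExponents hd).1 w.1.2))
      refine Finset.sum_le_sum fun i _ => (totalDegree_pow _ _).trans ?_
      rw [mul_comm]
      exact Nat.mul_le_mul_right _ (hQ i)
    · refine (totalDegree_pow _ _).trans ?_
      exact (Nat.mul_le_mul_left _ hℓ).trans (by have := w.2.2; omega)
  have hq : q x = 0 := by
    ext m
    rw [coeff_zero]
    by_cases hm : m ∈ (q x).support
    · have hmV : (m : ι → ℕ) ∈ V := by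
        rw [mem_weightedExponents (by simp)]
        refine le_trans (le_of_eq ?_) ((le_totalDegree hm).trans hdeg)
        simp [Finsupp.sum_fintype]
      have := congrFun (LinearMap.mem_ker.1 hx) ⟨m, hmV⟩
      simpa [F] using this
    · simpa using hm
  refine ⟨fun j => if h : j < D + 1 then ∑ w : W, monomial
    (Finsupp.equivFunOnFinite.symm (w : ι → ℕ)) (x (w, ⟨j, h⟩)) else 0, ?_, ?_⟩
  · obtain ⟨⟨w, j⟩, hw⟩ := Function.ne_iff.1 hx0
    refine ⟨j, by have := j.2; omega, fun h => hw ?_⟩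
    simp only [j.2, dif_pos] at h
    have := congrArg (coeff (Finsupp.equivFunOnFinite.symm (w : ι → ℕ))) h
    simpa [coeff_sum, coeff_monomial, Subtype.coe_inj] using this
  · rw [← hq, Finset.sum_range]
    simp only [q, Fintype.linearCombination_apply, Fintype.sum_prod_type]
    rw [Finset.sum_comm]
    refine Finset.sum_congr rfl fun j _ => ?_
    simp only [j.2, dif_pos, map_sum, bind₁_monomial, Finset.sum_mul]
    refine Finset.sum_congr rfl fun w _ => ?_
    rw [Algebra.smul_def, ← mul_assoc]
    congr 2
    exact Finset.prod_subset (Finset.subset_univ _) (by simp +contextual)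

end Relation

namespace ExpEqn

variable {ι : Type*} [Fintype ι] [DecidableEq ι]

omit [DecidableEq ι] in
lemma eval_bind₁_exp (Q : ι → MvPolynomial ι ℝ) (p : MvPolynomial ι ℝ) (t : ι → ℝ) :
    eval (fun a => Real.exp (t a)) (bind₁ Q p) = eval (map (fun i => poly (Q i)) t) p := by
  rw [← aeval_eq_eval, ← aeval_eq_eval]
  simp only [aeval_bind₁]
  rfl

/-- Bézout's inequality for the nondegenerate positive solutions of a polynomial system. -/
lemma card_le_prod_totalDegree (Q : ι → MvPolynomial ι ℝ) (Z : Finset (ι → ℝ))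
    (hZ : (Z : Set (ι → ℝ)) ⊆ regularZeros fun i => poly (Q i)) :
    Z.card ≤ ∏ i, (Q i).totalDegree := by
  classical
  by_cases h0 : ∃ i, (Q i).totalDegree = 0
  · obtain ⟨i, hi⟩ := h0
    have : Z = ∅ := by
      refine Finset.eq_empty_of_forall_notMem fun z hz => (hZ hz).2 ?_
      have : jac (fun i => poly (Q i)) = 0 := by
        refine Matrix.det_eq_zero_of_row_eq_zero i fun a => ?_
        rw [totalDegree_eq_zero_iff_eq_C] at hi
        simp only [Matrix.of_apply, grad]
        rw [hi]; simp
      simp [val, this]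
    simp [this]
  push Not at h0
  by_contra! hlt
  set D := ∏ i, (Q i).totalDegree
  set e : ι → ExpEqn ι := fun i => poly (Q i)
  obtain ⟨f, hf⟩ := Module.exists_dual_forall_apply_ne_zero (K := ℝ) (M := ι → ℝ)
    (fun p : {p : Z × Z // p.1 ≠ p.2} =>
      (fun a => Real.exp ((p.1.1 : ι → ℝ) a)) - fun a => Real.exp ((p.1.2 : ι → ℝ) a)) (by
    rintro ⟨⟨z, z'⟩, hne⟩ h
    refine hne (Subtype.ext (funext fun a => ?_))
    have := congrFun h a
    simpa [sub_eq_zero] using this)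
  set ℓ : MvPolynomial ι ℝ := ∑ a, C (f (Pi.single a 1)) * X a with hℓ
  have hℓf : ∀ v : ι → ℝ, eval v ℓ = f v := by
    intro v
    conv_rhs => rw [pi_eq_sum_univ' v]
    simp [ℓ, mul_comm]
  have hℓdeg : ℓ.totalDegree ≤ 1 := totalDegree_finsetSum_le fun a _ =>
    (totalDegree_mul _ _).trans (by simp)
  obtain ⟨p, ⟨j₀, hj₀, hpj⟩, hp⟩ := exists_algebraic_relation Q (fun i => (Q i).totalDegree)
    (fun i => Nat.one_le_iff_ne_zero.2 (h0 i)) (fun i => le_rfl) ℓ hℓdeg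
  set g : (ι → ℝ) → ℝ := (poly ℓ).val with hg
  have hgc : Continuous g := continuous_val _
  have hginj : InjOn g Z := by
    intro z hz z' hz' h
    by_contra hne
    refine hf ⟨(⟨z, hz⟩, ⟨z', hz'⟩), by simpa using hne⟩ ?_
    rw [map_sub, ← hℓf, ← hℓf]
    exact sub_eq_zero.2 h
  obtain ⟨U, hU, hdisj⟩ := (Z.finite_toSet.image g).t2_separation
  have hev : ∀ᶠ y in 𝓝 (0 : ι → ℝ), ∀ z ∈ Z, ∃ t, g t ∈ U (g z) ∧ map e t = y := by
    rw [Filter.eventually_all_finset]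
    intro z hz
    have h1 := map_nhds_eq e (hZ hz).2
    rw [(hZ hz).1] at h1
    rw [← h1, Filter.eventually_map]
    filter_upwards [hgc.continuousAt.preimage_mem_nhds ((hU (g z)).2.mem_nhds (hU (g z)).1)]
      with t ht using ⟨t, ht, rfl⟩
  have hzero : ∀ᶠ y in 𝓝 (0 : ι → ℝ), eval y (p j₀) = 0 := by
    filter_upwards [hev] with y hy
    choose! t htU hty using hy
    set P : Polynomial ℝ := ∑ j ∈ Finset.range (D + 1), Polynomial.C (eval y (p j)) *
      Polynomial.X ^ j with hP
    have hPdeg : P.natDegree < Z.card := by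
      refine lt_of_le_of_lt (Polynomial.natDegree_sum_le_of_forall_le _ _ (n := D)
        fun j hj => ?_) hlt
      refine (Polynomial.natDegree_C_mul_X_pow_le _ _).trans ?_
      have := Finset.mem_range.1 hj; omega
    have hP0 : P = 0 := by
      refine Polynomial.eq_zero_of_natDegree_lt_card_of_eval_eq_zero' P
        (Z.image fun z => g (t z)) ?_ ?_
      · intro r hr
        obtain ⟨z, hz, rfl⟩ := Finset.mem_image.1 hr
        have := congrArg (eval fun a => Real.exp (t z a)) hp
        simp only [map_sum, map_mul, map_pow, eval_bind₁_exp, map_zero] at this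
        have hyz : map (fun i => poly (Q i)) (t z) = y := hty z hz
        rw [hyz] at this
        simpa [P, Polynomial.eval_finsetSum, hg, val] using this
      · rwa [Finset.card_image_of_injOn]
        intro z hz z' hz' h
        by_contra hne
        have h2 := hdisj (mem_image_of_mem g hz) (mem_image_of_mem g hz')
          (fun h => hne (hginj hz hz' h))
        refine Set.disjoint_left.1 h2 (htU z hz) ?_
        have h : g (t z) = g (t z') := h
        rw [h]
        exact htU z' hz'
    have := congrArg (fun P => Polynomial.coeff P j₀) hP0
    simp [P, Polynomial.coeff_C_mul, Polynomial.coeff_X_pow] at this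
    exact this hj₀
  refine hpj ?_
  obtain ⟨ε, hε, hball⟩ := Metric.eventually_nhds_iff_ball.1 hzero
  refine MvPolynomial.funext_set (fun _ => Metric.ball (0 : ℝ) ε) (fun _ => ?_) fun x hx => ?_
  · rw [Real.ball_eq_Ioo]; exact Ioo_infinite (by linarith)
  · rw [map_zero]
    refine hball x ?_
    rw [mem_ball_zero_iff, pi_norm_lt_iff hε]
    intro i
    simpa using hx i (mem_univ i)

/-- Exponentiate a coordinate equation. -/
noncomputable def toPoly : ExpEqn ι → MvPolynomial ι ℝ
  | lin _ _ => 0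
  | coord a c => X a - C (Real.exp c)
  | poly P => P

lemma regularZeros_toPoly {e : ι → ExpEqn ι} (he : ∀ i, ¬ (e i).IsLin) :
    regularZeros (fun i => poly (e i).toPoly) = regularZeros e := by
  have hv : ∀ i t, (poly (e i).toPoly).val t = 0 ↔ (e i).val t = 0 := by
    intro i t
    have := he i
    rcases h : e i with ⟨w, c⟩ | ⟨a, c⟩ | P
    · simp [h, IsLin] at this
    · simp [val, toPoly, sub_eq_zero]
    · rfl
  have hd : ∀ i t v, (poly (e i).toPoly).deriv t v = 0 ↔ (e i).deriv t v = 0 := by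
    intro i t v
    have := he i
    rcases h : e i with ⟨w, c⟩ | ⟨a, c⟩ | P
    · simp [h, IsLin] at this
    · rw [deriv_apply, deriv_apply, Finset.sum_eq_single a, Finset.sum_eq_single a]
      · simp [grad, toPoly, Real.exp_ne_zero]
      · intro b _ hb; simp [grad, hb]
      · simp
      · intro b _ hb; simp [grad, toPoly, hb.symm]
      · simp
    · rfl
  ext t
  simp only [regularZeros, mem_ofPred_eq, val_jac_ne_zero_iff]
  refine and_congr ?_ (forall_congr' fun v => ?_)
  · simp [map, funext_iff, hv]
  · simp [hd]

omit [Fintype ι] [DecidableEq ι] in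
lemma totalDegree_toPoly_le (e : ExpEqn ι) : e.toPoly.totalDegree ≤ e.bezoutDegree := by
  rcases e with ⟨w, c⟩ | ⟨a, c⟩ | P
  · simp [toPoly]
  · exact (totalDegree_sub_C_le _ _).trans (by simp [bezoutDegree])
  · rfl

/-- Bézout's inequality for a system without affine-linear equations. -/
lemma card_le_prod_bezoutDegree {e : ι → ExpEqn ι} (he : ∀ i, ¬ (e i).IsLin)
    (Z : Finset (ι → ℝ)) (hZ : (Z : Set (ι → ℝ)) ⊆ regularZeros e) :
    Z.card ≤ ∏ i, (e i).bezoutDegree := by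
  rw [← regularZeros_toPoly he] at hZ
  exact (card_le_prod_totalDegree _ Z hZ).trans
    (Finset.prod_le_prod' fun i _ => totalDegree_toPoly_le _)

end ExpEqn

end

section

open Set Filter Topology MvPolynomial

namespace ExpEqn

variable {ι : Type*} [Fintype ι] [DecidableEq ι]

section Curve

variable {e : ι → ExpEqn ι} {i₁ : ι} {c : ι → ℝ} {C O : Set (ι → ℝ)}

/-- The counting form of Rolle's theorem on the curve cut out by all equations of a system but
one: the solutions of the last equation in the interior of a compact piece of the curve are at most
half as numerous as the boundary points. -/
lemma two_mul_ncard_le_ncard_boundary (hC : IsCompact C)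
    (hJ : ∀ t ∈ C, (poly (jac e)).val t ≠ 0) (hCc : ∀ t ∈ C, ∀ i ≠ i₁, (e i).val t = c i)
    (hO : IsOpen O) (hOC : ∀ t ∈ O, (∀ i ≠ i₁, (e i).val t = c i) → t ∈ C)
    (hfin : (C \ O).Finite) :
    {t | t ∈ C ∧ t ∈ O ∧ (e i₁).val t = 0}.Finite ∧
      2 * {t | t ∈ C ∧ t ∈ O ∧ (e i₁).val t = 0}.ncard ≤ (C \ O).ncard := by
  have : CompactSpace C := isCompact_iff_compactSpace.1 hC
  set ψ : C → ℝ := fun t => (e i₁).val t with hψ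
  have hψc : Continuous ψ := (continuous_val _).comp continuous_subtype_val
  have hinj : ∀ x : C, ∃ U ∈ 𝓝 x, InjOn ψ U := by
    intro x
    obtain ⟨U, hU, hUi⟩ := exists_injOn_nhds e (hJ x x.2)
    refine ⟨Subtype.val ⁻¹' U, continuous_subtype_val.continuousAt.preimage_mem_nhds hU, ?_⟩
    intro y hy y' hy' h
    refine Subtype.ext (hUi hy hy' (funext fun i => ?_))
    by_cases hi : i = i₁
    · subst hi; exact h
    · exact (hCc y y.2 i hi).trans (hCc y' y'.2 i hi).symm
  set B : Set C := {x | (x : ι → ℝ) ∉ O} with hB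
  have hBimg : Subtype.val '' B = C \ O := by
    ext t; simp [B, and_comm]
  have hBfin : B.Finite := Set.Finite.of_finite_image (hBimg ▸ hfin) Subtype.val_injective.injOn
  have hopen : ∀ x ∉ B, 𝓝 (ψ x) ≤ Filter.map ψ (𝓝 x) := by
    intro x hx S hS
    rw [Filter.mem_map, nhds_subtype_eq_comap, Filter.mem_comap] at hS
    obtain ⟨V, hV, hVS⟩ := hS
    have hxO : (x : ι → ℝ) ∈ O := by simpa [B] using hx
    have h1 : map e '' (V ∩ O) ∈ 𝓝 (map e x) := by
      rw [← map_nhds_eq e (hJ x x.2)]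
      exact image_mem_map (inter_mem hV (hO.mem_nhds hxO))
    have h2 : ContinuousAt (fun y => Function.update (map e x) i₁ y) (ψ x) :=
      (continuous_const.update i₁ continuous_id).continuousAt
    have h3 : Function.update (map e x) i₁ (ψ x) = map e x := Function.update_eq_self _ _
    have h4 := h2.preimage_mem_nhds (t := map e '' (V ∩ O)) (by rw [h3]; exact h1)
    filter_upwards [h4] with y hy
    obtain ⟨t, ⟨htV, htO⟩, hty⟩ := hy
    replace hty : map e t = Function.update (map e x) i₁ y := hty
    have htC : t ∈ C := hOC t htO fun i hi => by
      have := congrFun hty i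
      rw [Function.update_of_ne hi] at this
      exact this.trans (hCc x x.2 i hi)
    have hyS : (⟨t, htC⟩ : C) ∈ ψ ⁻¹' S := hVS htV
    have : ψ ⟨t, htC⟩ = y := by
      have := congrFun hty i₁
      rwa [Function.update_self] at this
    rw [← this]; exact hyS
  have key := two_mul_ncard_fibre_diff_le hψc hinj hBfin hopen
  have himg : Subtype.val '' (ψ ⁻¹' {0} \ B) = {t | t ∈ C ∧ t ∈ O ∧ (e i₁).val t = 0} := by
    ext t; simp [B, ψ]; tauto
  rw [← himg, ← hBimg, ncard_image_of_injective _ Subtype.val_injective,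
    ncard_image_of_injective _ Subtype.val_injective]
  exact ⟨((finite_fibre_of_locally_injective hψc hinj 0).subset sdiff_subset).image _, key⟩

end Curve

/-- The system `e = c`. -/
noncomputable def shiftAll (e : ι → ExpEqn ι) (c : ι → ℝ) : ι → ExpEqn ι :=
  fun i => (e i).shift (c i)

lemma mem_regularZeros_shiftAll {e : ι → ExpEqn ι} {c t : ι → ℝ} :
    t ∈ regularZeros (shiftAll e c) ↔ map e t = c ∧ (poly (jac e)).val t ≠ 0 := by
  have h : jac (shiftAll e c) = jac e := by simp [jac, shiftAll, grad_shift]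
  simp [regularZeros, h, map, shiftAll, val_shift, funext_iff, sub_eq_zero]

/-- The recursive bound for the number of nondegenerate solutions of a system with `j` affine-linear
equations, in `E` variables. -/
def rolleBound (E : ℕ) : ℕ → ℕ → ℕ
  | 0, _ => 1
  | j + 1, D => D * rolleBound E j (2 * D) + E * rolleBound E j D

/-- The equations bounding a compact piece of a curve. -/
noncomputable def boundaryEqn (J : MvPolynomial ι ℝ) (R : ℝ) : Bool ⊕ (ι × Bool) → ExpEqn ι
  | .inl true => poly J
  | .inl false => poly (-J)
  | .inr (a, true) => coord a R
  | .inr (a, false) => coord a (-R)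

/-- Finitely many nondegenerate solutions of a system persist on a generic compact piece of a
nearby curve. -/
lemma exists_generic_piece (e : ι → ExpEqn ι) (i₁ : ι) (Z : Finset (ι → ℝ))
    (hZ : (Z : Set (ι → ℝ)) ⊆ regularZeros e) :
    ∃ (R : ℝ) (c : ι → ℝ), 0 < c i₁ ∧
      (∀ β t, map (Function.update e i₁ (boundaryEqn (jac e) R β)) t = c →
        (poly (jac (Function.update e i₁ (boundaryEqn (jac e) R β)))).val t ≠ 0) ∧
      ∃ t : (ι → ℝ) → ι → ℝ, InjOn t Z ∧ ∀ z ∈ Z, (∀ i ≠ i₁, (e i).val (t z) = c i) ∧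
        (e i₁).val (t z) = 0 ∧ c i₁ < |(poly (jac e)).val (t z)| ∧
        ∀ a, -R + c i₁ < t z a ∧ t z a < R + c i₁ := by
  obtain ⟨s₀, hs₀, hs⟩ : ∃ s₀ > 0, ∀ z ∈ Z, s₀ < |(poly (jac e)).val z| := by
    have h : ∀ᶠ s in 𝓝[>] (0 : ℝ), ∀ z ∈ Z, s < |(poly (jac e)).val z| := by
      rw [Filter.eventually_all_finset]
      intro z hz
      exact nhdsWithin_le_nhds (gt_mem_nhds (abs_pos.2 (hZ hz).2))
    obtain ⟨s, hs, hs0⟩ := (h.and self_mem_nhdsWithin).exists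
    exact ⟨s, hs0, hs⟩
  obtain ⟨R₀, hR⟩ : ∃ R₀ : ℝ, ∀ z ∈ Z, ∀ a, |z a| < R₀ := by
    have h : ∀ᶠ R in (atTop : Filter ℝ), ∀ z ∈ Z, ∀ a, |z a| < R := by
      rw [Filter.eventually_all_finset]
      intro z hz
      exact Filter.eventually_all.2 fun a => eventually_gt_atTop _
    exact h.exists
  set V : Set (ι → ℝ) := {t | s₀ < |(poly (jac e)).val t| ∧ ∀ a, |t a| < R₀} with hV
  have hVo : IsOpen V := by
    refine (isOpen_lt continuous_const (continuous_val _).abs).inter ?_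
    change IsOpen {t : ι → ℝ | ∀ a, |t a| < R₀}
    simp only [ofPred_forall]
    exact isOpen_iInter_of_finite fun a => isOpen_lt (continuous_apply a).abs continuous_const
  obtain ⟨U, hU, hdisj⟩ := Z.finite_toSet.t2_separation
  have hev : ∀ᶠ y in 𝓝 (0 : ι → ℝ), ∀ z ∈ Z, ∃ t ∈ U z ∩ V, map e t = y := by
    rw [Filter.eventually_all_finset]
    intro z hz
    have h1 := map_nhds_eq e (hZ hz).2
    rw [(hZ hz).1] at h1
    rw [← h1, Filter.eventually_map]
    filter_upwards [((hU z).2.inter hVo).mem_nhds ⟨(hU z).1, hs z hz, hR z hz⟩]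
      with t ht using ⟨t, ht, rfl⟩
  have hup : Tendsto (fun c : ι → ℝ => Function.update c i₁ 0) (𝓝 0) (𝓝 0) := by
    have : Continuous fun c : ι → ℝ => Function.update c i₁ 0 :=
      continuous_id.update i₁ continuous_const
    simpa using this.tendsto 0
  have hsmall : ∀ᶠ c in 𝓝 (0 : ι → ℝ), c i₁ < min s₀ 1 :=
    (continuous_apply i₁).continuousAt.eventually_lt continuousAt_const
      (by simpa using hs₀)
  obtain ⟨N, hN, hNo, hN0⟩ := eventually_nhds_iff.1 ((hup.eventually hev).and hsmall)
  have hNne : (N ∩ {c | 0 < c i₁}).Nonempty := by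
    have h1 : Tendsto (fun r : ℝ => (Pi.single i₁ r : ι → ℝ)) (𝓝[>] 0) (𝓝 0) := by
      have : Continuous fun r : ℝ => (Pi.single i₁ r : ι → ℝ) :=
        continuous_const.update i₁ continuous_id
      simpa using (this.tendsto 0).mono_left nhdsWithin_le_nhds
    obtain ⟨r, hr, hr0⟩ := ((h1.eventually (hNo.mem_nhds hN0)).and self_mem_nhdsWithin).exists
    exact ⟨_, hr, by simpa using hr0⟩
  have hae : ∀ᵐ c ∂(MeasureTheory.volume : MeasureTheory.Measure (ι → ℝ)),
      ∀ β t, map (Function.update e i₁ (boundaryEqn (jac e) (R₀ + 1) β)) t = c →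
        (poly (jac (Function.update e i₁ (boundaryEqn (jac e) (R₀ + 1) β)))).val t ≠ 0 :=
    MeasureTheory.ae_all_iff.2 fun β => ae_forall_val_jac_ne_zero _
  obtain ⟨c, ⟨hcN, hc0⟩, hc⟩ := (MeasureTheory.Measure.dense_of_ae hae).inter_open_nonempty _
    (hNo.inter (isOpen_lt continuous_const (continuous_apply i₁))) hNne
  obtain ⟨hcz, hcs⟩ := hN c hcN
  choose! t ht htc using hcz
  have hc1 : c i₁ < 1 := hcs.trans_le (min_le_right _ _)
  have hcs₀ : c i₁ < s₀ := hcs.trans_le (min_le_left _ _)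
  have hc0 : 0 < c i₁ := hc0
  refine ⟨R₀ + 1, c, hc0, hc, t, ?_, fun z hz => ⟨fun i hi => ?_, ?_, ?_, fun a => ?_⟩⟩
  · intro z hz z' hz' h
    by_contra hne
    exact Set.disjoint_left.1 (hdisj hz hz' hne) (ht z hz).1 (h ▸ (ht z' hz').1)
  · have := congrFun (htc z hz) i
    rwa [Function.update_of_ne hi] at this
  · have := congrFun (htc z hz) i₁
    rwa [Function.update_self] at this
  · exact hcs₀.trans (ht z hz).2.1
  · have := abs_lt.1 ((ht z hz).2.2 a)
    constructor <;> linarith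

lemma card_le_of_boundary (e : ι → ExpEqn ι) (i₁ : ι) (Z : Finset (ι → ℝ))
    (hZ : (Z : Set (ι → ℝ)) ⊆ regularZeros e) (m : Bool ⊕ (ι × Bool) → ℕ)
    (hm : ∀ R c β (Y : Finset (ι → ℝ)), (Y : Set (ι → ℝ)) ⊆ regularZeros
      (shiftAll (Function.update e i₁ (boundaryEqn (jac e) R β)) c) → Y.card ≤ m β) :
    2 * Z.card ≤ ∑ β, m β := by
  classical
  obtain ⟨R, c, hc0, hreg, t, htinj, ht⟩ := exists_generic_piece e i₁ Z hZ
  set J := (poly (jac e)).val with hJ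
  have hJc : Continuous J := continuous_val _
  set C : Set (ι → ℝ) := {t | (∀ i ≠ i₁, (e i).val t = c i) ∧ c i₁ ≤ |J t| ∧
    ∀ a, -R + c i₁ ≤ t a ∧ t a ≤ R + c i₁} with hC
  set O : Set (ι → ℝ) := {t | c i₁ < |J t| ∧
    ∀ a, -R + c i₁ < t a ∧ t a < R + c i₁} with hO
  set S : Bool ⊕ (ι × Bool) → Set (ι → ℝ) := fun β => regularZeros
      (shiftAll (Function.update e i₁ (boundaryEqn (jac e) R β)) c) with hS
  have hSfin : ∀ β, (S β).Finite := fun β => by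
    by_contra h
    obtain ⟨Y, hY, hYc⟩ := Set.Infinite.exists_subset_card_eq h (m β + 1)
    have := hm R c β Y hY
    omega
  have hCO : C \ O ⊆ ⋃ β, S β := by
    rintro t ⟨⟨htc, htJ, hta⟩, htO⟩
    have hmem : ∀ β, (boundaryEqn (jac e) R β).val t = c i₁ → t ∈ ⋃ β, S β := by
      intro β hβ
      refine mem_iUnion.2 ⟨β, ?_⟩
      have hmap : map (Function.update e i₁ (boundaryEqn (jac e) R β)) t = c := by
        funext i
        by_cases hi : i = i₁
        · subst hi; simpa [map] using hβ
        · simpa [map, hi] using htc i hi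
      exact mem_regularZeros_shiftAll.2 ⟨hmap, hreg β t hmap⟩
    by_contra hcon
    refine htO ⟨lt_of_le_of_ne htJ fun h => ?_, fun a => ⟨lt_of_le_of_ne (hta a).1 fun h => ?_,
      lt_of_le_of_ne (hta a).2 fun h => ?_⟩⟩
    · rcases abs_choice (J t) with h' | h'
      · exact hcon (hmem (.inl true) (by rw [h, h']; rfl))
      · exact hcon (hmem (.inl false) (by rw [h, h']; simp [boundaryEqn, val, J]))
    · exact hcon (hmem (.inr (a, false)) (by simp [boundaryEqn, val, ← h]))
    · exact hcon (hmem (.inr (a, true)) (by simp [boundaryEqn, val, h]))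
  have hfin : (C \ O).Finite := (Set.finite_iUnion hSfin).subset hCO
  have hCclosed : IsClosed C := by
    refine IsClosed.inter ?_ (IsClosed.inter (isClosed_le continuous_const hJc.abs) ?_)
    · change IsClosed {t : ι → ℝ | ∀ i ≠ i₁, (e i).val t = c i}
      simp only [ofPred_forall]
      exact isClosed_iInter fun i => isClosed_iInter fun _ =>
        isClosed_eq (continuous_val _) continuous_const
    · change IsClosed {t : ι → ℝ | ∀ a, -R + c i₁ ≤ t a ∧ t a ≤ R + c i₁}
      simp only [ofPred_forall]
      exact isClosed_iInter fun a => (isClosed_le continuous_const (continuous_apply a)).inter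
        (isClosed_le (continuous_apply a) continuous_const)
  have hCcomp : IsCompact C := (isCompact_Icc (a := fun _ : ι => -R + c i₁)
    (b := fun _ => R + c i₁)).of_isClosed_subset hCclosed
    fun t ht => ⟨fun a => (ht.2.2 a).1, fun a => (ht.2.2 a).2⟩
  have hOo : IsOpen O := by
    refine IsOpen.inter (isOpen_lt continuous_const hJc.abs) ?_
    change IsOpen {t : ι → ℝ | ∀ a, -R + c i₁ < t a ∧ t a < R + c i₁}
    simp only [ofPred_forall]
    exact isOpen_iInter_of_finite fun a => (isOpen_lt continuous_const (continuous_apply a)).inter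
        (isOpen_lt (continuous_apply a) continuous_const)
  obtain ⟨hfin', hle⟩ := two_mul_ncard_le_ncard_boundary (e := e) (i₁ := i₁) (c := c) hCcomp
    (fun t ht => abs_pos.1 (hc0.trans_le ht.2.1)) (fun t ht => ht.1) hOo
    (fun t ht htc => ⟨htc, ht.1.le, fun a => ⟨(ht.2 a).1.le, (ht.2 a).2.le⟩⟩) hfin
  have hZle : Z.card ≤ {t | t ∈ C ∧ t ∈ O ∧ (e i₁).val t = 0}.ncard := by
    rw [← Finset.card_image_of_injOn htinj, ← ncard_coe_finset]
    refine ncard_le_ncard (fun y hy => ?_) hfin'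
    rw [Finset.coe_image] at hy
    obtain ⟨z, hz, rfl⟩ := hy
    obtain ⟨h1, h2, h3, h4⟩ := ht z hz
    exact ⟨⟨h1, h3.le, fun a => ⟨(h4 a).1.le, (h4 a).2.le⟩⟩, ⟨h3, h4⟩, h2⟩
  have hCOle : (C \ O).ncard ≤ ∑ β, m β := by
    have h1 : hfin.toFinset ⊆ Finset.univ.biUnion fun β => (hSfin β).toFinset := by
      intro t ht
      obtain ⟨β, hβ⟩ := mem_iUnion.1 (hCO (hfin.mem_toFinset.1 ht))
      exact Finset.mem_biUnion.2 ⟨β, Finset.mem_univ _, (hSfin β).mem_toFinset.2 hβ⟩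
    rw [ncard_eq_toFinset_card _ hfin]
    refine (Finset.card_le_card h1).trans (Finset.card_biUnion_le.trans ?_)
    exact Finset.sum_le_sum fun β _ => hm R c β _ (by simp [S])
  omega

/-- Khovanskii's bound for the number of nondegenerate solutions of a system mixing affine-linear
equations in `t` and polynomial equations in `exp t`. -/
theorem card_le_rolleBound (j : ℕ) : ∀ (e : ι → ExpEqn ι) (D : ℕ),
    {i | (e i).IsLin}.ncard = j → ∑ i, (e i).gradDegree ≤ D → ∀ Z : Finset (ι → ℝ),
    (Z : Set (ι → ℝ)) ⊆ regularZeros e →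
    Z.card ≤ rolleBound (Fintype.card ι) j D * ∏ i, (e i).bezoutDegree := by
  induction j with
  | zero =>
    intro e D hj _ Z hZ
    rw [ncard_eq_zero] at hj
    rw [rolleBound, one_mul]
    exact card_le_prod_bezoutDegree (fun i hi => (Set.ext_iff.1 hj i).1 hi) Z hZ
  | succ j ih =>
    intro e D hj hD Z hZ
    obtain ⟨i₁, hi₁⟩ : {i | (e i).IsLin}.Nonempty := by
      rw [← ncard_pos]; omega
    set P := ∏ i ∈ Finset.univ.erase i₁, (e i).bezoutDegree with hP
    set E := Fintype.card ι
    have hgi : (e i₁).gradDegree = 0 ∧ (e i₁).bezoutDegree = 1 := by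
      rcases h : e i₁ with ⟨w, c⟩ | ⟨a, c⟩ | Q <;> simp [h, IsLin, gradDegree, bezoutDegree] at hi₁ ⊢
    have hprod : ∏ i, (e i).bezoutDegree = P := by
      rw [← Finset.mul_prod_erase _ _ (Finset.mem_univ i₁), hgi.2, one_mul]
    have hsum : ∑ i ∈ Finset.univ.erase i₁, (e i).gradDegree ≤ D := by
      rwa [← Finset.add_sum_erase _ _ (Finset.mem_univ i₁), hgi.1, zero_add] at hD
    have hJ : (jac e).totalDegree ≤ D := (totalDegree_jac_le e).trans hD
    have hstep : ∀ (b : ExpEqn ι), ¬ b.IsLin → ∀ (D' : ℕ) (c : ι → ℝ) (Y : Finset (ι → ℝ)),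
        b.gradDegree + D ≤ D' → (Y : Set (ι → ℝ)) ⊆ regularZeros
          (shiftAll (Function.update e i₁ b) c) →
        Y.card ≤ rolleBound E j D' * (b.bezoutDegree * P) := by
      intro b hb D' c Y hD' hY
      refine (ih _ D' ?_ ?_ Y hY).trans (Nat.mul_le_mul_left _ ?_)
      · have : {i | (shiftAll (Function.update e i₁ b) c i).IsLin} = {i | (e i).IsLin} \ {i₁} := by
          ext i
          by_cases hi : i = i₁
          · subst hi; simp [shiftAll, isLin_shift, hb]
          · simp [shiftAll, isLin_shift, hi]
        rw [this, ncard_sdiff_singleton_of_mem hi₁, hj]; rfl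
      · refine (Finset.sum_le_sum fun i _ => gradDegree_shift_le _ _).trans ?_
        rw [← Finset.add_sum_erase _ _ (Finset.mem_univ i₁), Function.update_self]
        refine le_trans (Nat.add_le_add_left ?_ _) hD'
        refine le_trans (le_of_eq (Finset.sum_congr rfl fun i hi => ?_)) hsum
        rw [Function.update_of_ne (Finset.ne_of_mem_erase hi)]
      · refine (Finset.prod_le_prod' fun i _ => bezoutDegree_shift_le _ _).trans (le_of_eq ?_)
        rw [← Finset.mul_prod_erase _ _ (Finset.mem_univ i₁), Function.update_self]
        congr 1
        refine Finset.prod_congr rfl fun i hi => ?_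
        rw [Function.update_of_ne (Finset.ne_of_mem_erase hi)]
    have key := card_le_of_boundary e i₁ Z hZ
      (Sum.elim (fun _ => rolleBound E j (2 * D) * (D * P)) fun _ => rolleBound E j D * P) (by
      rintro R c (β | ⟨a, β⟩) Y hY
      · cases β
        · refine (hstep _ (by simp [boundaryEqn, IsLin]) (2 * D) c Y ?_ hY).trans ?_
          · simp only [boundaryEqn, gradDegree, totalDegree_neg]; omega
          · simp only [boundaryEqn, bezoutDegree, totalDegree_neg, Sum.elim_inl]; gcongr
        · refine (hstep _ (by simp [boundaryEqn, IsLin]) (2 * D) c Y ?_ hY).trans ?_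
          · simp only [boundaryEqn, gradDegree]; omega
          · simp only [boundaryEqn, bezoutDegree, Sum.elim_inl]; gcongr
      · cases β <;>
        · refine (hstep _ (by simp [boundaryEqn, IsLin]) D c Y ?_ hY).trans ?_
          · simp [boundaryEqn, gradDegree]
          · simp [boundaryEqn, bezoutDegree])
    rw [hprod, rolleBound]
    simp only [Fintype.sum_sum_type, Sum.elim_inl, Sum.elim_inr, Finset.sum_const,
      Finset.card_univ, Fintype.card_prod, Fintype.card_bool, smul_eq_mul] at key
    nlinarith [key]

end ExpEqn

end

section

open Set Filter Topology

lemma exists_separating_opens {E : Type*} [MetricSpace E] {K Y : Set E} (hK : IsCompact (Y ∩ K))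
    {S : Finset E} (hSne : S.Nonempty) (hS : (S : Set E) ⊆ Y ∩ K)
    (hdist : InjOn (connectedComponentIn Y) S) :
    ∃ U : S → Set E, (∀ y, IsOpen (U y)) ∧ (∀ y y', y ≠ y' → Disjoint (U y) (U y')) ∧
      (∀ y, (y : E) ∈ U y) ∧ Y ∩ K ⊆ ⋃ y, U y := by
  classical
  set X := Y ∩ K
  have : CompactSpace X := isCompact_iff_compactSpace.1 hK
  have : Nonempty S := hSne.to_subtype
  let j : S → X := fun y => ⟨y, hS y.2⟩
  have hclopen : ∀ p : S × S, ∃ V : Set X, IsClopen V ∧ (p.1 ≠ p.2 → j p.1 ∈ V ∧ j p.2 ∉ V) := by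
    rintro ⟨y, y'⟩
    by_cases h : y = y'
    · exact ⟨univ, isClopen_univ, fun h' => absurd h h'⟩
    have hnot : j y' ∉ connectedComponent (j y) := by
      intro hmem
      have h1 : IsPreconnected (Subtype.val '' connectedComponent (j y)) :=
        isPreconnected_connectedComponent.image _ continuous_subtype_val.continuousOn
      have h2 : (y' : E) ∈ connectedComponentIn Y y := by
        refine h1.subset_connectedComponentIn ⟨j y, mem_connectedComponent, rfl⟩ ?_
          ⟨j y', hmem, rfl⟩
        rintro _ ⟨x, _, rfl⟩
        exact x.2.1
      exact h (Subtype.ext (hdist y.2 y'.2 (connectedComponentIn_eq h2)))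
    rw [connectedComponent_eq_iInter_isClopen, mem_iInter] at hnot
    push Not at hnot
    obtain ⟨⟨V, hV, hyV⟩, hV'⟩ := hnot
    exact ⟨V, hV, fun _ => ⟨hyV, hV'⟩⟩
  choose V hV hVsep using hclopen
  let Φ : X → S × S → Bool := fun x p => decide (x ∈ V p)
  have hΦ : IsLocallyConstant Φ := by
    refine (IsLocallyConstant.iff_continuous _).2 (continuous_pi fun p => ?_)
    refine (continuous_bool_rng true).2 ?_
    convert hV p using 1
    ext x; simp [Φ]
  have hinj : Function.Injective (Φ ∘ j) := by
    intro y y' h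
    by_contra hne
    have h1 := congrFun h (y, y')
    have h2 := hVsep (y, y') hne
    simp [Φ, h2.1, h2.2] at h1
  let g : X → S := Function.invFun (Φ ∘ j) ∘ Φ
  have hg : IsLocallyConstant g := hΦ.comp _
  have hgj : ∀ y, g (j y) = y := Function.leftInverse_invFun hinj
  let C : S → Set E := fun y => Subtype.val '' (g ⁻¹' {y})
  have hCc : ∀ y, IsClosed (C y) := fun y =>
    (((hg.isClosed_fiber y).isCompact).image continuous_subtype_val).isClosed
  have hyC : ∀ y : S, (y : E) ∈ C y := fun y => ⟨j y, hgj y, rfl⟩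
  have hCdisj : ∀ x y y', x ∈ C y → x ∈ C y' → y = y' := by
    rintro _ y y' ⟨x, hx, rfl⟩ ⟨x', hx', hxx⟩
    rw [← show g x = y from hx, ← show g x' = y' from hx', Subtype.ext hxx]
  have hCU : ∀ y, ∀ x ∈ C y, ∀ y' ≠ y, Metric.infDist x (C y) < Metric.infDist x (C y') := by
    intro y x hx y' hy'
    rw [Metric.infDist_zero_of_mem hx]
    exact ((hCc y').notMem_iff_infDist_pos ⟨_, hyC y'⟩).1 fun h => hy' (hCdisj x y' y h hx)
  refine ⟨fun y => {x | ∀ y' ≠ y, Metric.infDist x (C y) < Metric.infDist x (C y')}, ?_, ?_, ?_, ?_⟩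
  · intro y
    simp only [ofPred_forall]
    exact isOpen_iInter_of_finite fun y' => isOpen_iInter_of_finite fun _ =>
      isOpen_lt (Metric.continuous_infDist_pt _) (Metric.continuous_infDist_pt _)
  · intro y y' h
    refine Set.disjoint_left.2 fun x hx hx' => ?_
    exact lt_asymm (hx y' (Ne.symm h)) (hx' y h)
  · exact fun y => hCU y y (hyC y)
  · intro x hx
    exact mem_iUnion.2 ⟨g ⟨x, hx⟩, hCU _ x ⟨⟨x, hx⟩, rfl, rfl⟩⟩

section Minimizers

variable {κ : Type*} [Fintype κ]

/-- The simplex `{u | ∀ j, -R ≤ u j, ∑ u ≤ L}`. -/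
def bigSimplex (κ : Type*) [Fintype κ] (R L : ℝ) : Set (κ → ℝ) :=
  {u | (∀ j, -R ≤ u j) ∧ ∑ j, u j ≤ L}

lemma isCompact_bigSimplex (R L : ℝ) : IsCompact (bigSimplex κ R L) := by
  classical
  refine (isCompact_Icc (a := fun _ : κ => -R)
    (b := fun _ => L + Fintype.card κ * |R|)).of_isClosed_subset ?_ ?_
  · refine IsClosed.inter ?_ (isClosed_le (f := fun u : κ → ℝ => ∑ j, u j) (by fun_prop)
      continuous_const)
    change IsClosed {u : κ → ℝ | ∀ j, -R ≤ u j}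
    simp only [ofPred_forall]
    exact isClosed_iInter fun j => isClosed_le continuous_const (continuous_apply j)
  · intro u hu
    refine ⟨hu.1, fun j => ?_⟩
    have h1 := Finset.add_sum_erase Finset.univ u (Finset.mem_univ j)
    have h2 : ∑ i ∈ Finset.univ.erase j, -|R| ≤ ∑ i ∈ Finset.univ.erase j, u i :=
      Finset.sum_le_sum fun i _ => (neg_le_neg (le_abs_self R)).trans (hu.1 i)
    have h3 : ((Finset.univ.erase j).card : ℝ) ≤ Fintype.card κ := by
      exact_mod_cast Finset.card_le_univ _
    rw [Finset.sum_const, nsmul_eq_mul] at h2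
    have h4 := hu.2
    have h5 := mul_le_mul_of_nonneg_right h3 (abs_nonneg R)
    change u j ≤ L + Fintype.card κ * |R|
    linarith

/-- Points in distinct components of a hypersurface `F = 0`, near which `F` changes sign, give
rise to distinct local minimizers of `∑ u` on the truncation of any nearby hypersurface. -/
lemma exists_local_minimizers {F : (κ → ℝ) → ℝ} (hF : Continuous F) (S : Finset (κ → ℝ))
    (hS : ∀ y ∈ S, F y = 0) (hpos : ∀ y ∈ S, y ∈ closure {u | 0 < F u})
    (hneg : ∀ y ∈ S, y ∈ closure {u | F u < 0})
    (hdist : InjOn (connectedComponentIn {u | F u = 0}) S) :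
    ∃ R L δ : ℝ, 0 < δ ∧ ∀ G : (κ → ℝ) → ℝ, Continuous G →
      (∀ u ∈ bigSimplex κ R L, |G u - F u| < δ) →
      ∃ m : (κ → ℝ) → κ → ℝ, InjOn m S ∧ ∀ y ∈ S, G (m y) = 0 ∧ (∀ j, -R ≤ m y j) ∧
        ∀ᶠ u in 𝓝 (m y), G u = 0 → (∀ j, -R ≤ u j) → ∑ j, m y j ≤ ∑ j, u j := by
  classical
  rcases S.eq_empty_or_nonempty with rfl | hSne
  · exact ⟨0, 0, 1, one_pos, fun G _ _ => ⟨id, by simp, by simp⟩⟩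
  obtain ⟨R, hR⟩ : ∃ R : ℝ, ∀ y ∈ S, ∀ j, -R < y j := by
    have h : ∀ᶠ R in (atTop : Filter ℝ), ∀ y ∈ S, ∀ j, -R < y j := by
      rw [Filter.eventually_all_finset]
      intro y hy
      refine Filter.eventually_all.2 fun j => ?_
      filter_upwards [eventually_gt_atTop (-y j)] with R hR
      linarith
    exact h.exists
  obtain ⟨L, hL⟩ : ∃ L : ℝ, ∀ y ∈ S, ∑ j, y j < L := by
    have h : ∀ᶠ L in (atTop : Filter ℝ), ∀ y ∈ S, ∑ j, y j < L := by
      rw [Filter.eventually_all_finset]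
      exact fun y hy => eventually_gt_atTop _
    exact h.exists
  set K := bigSimplex κ R L
  have hKc : IsCompact K := isCompact_bigSimplex R L
  have hY : IsClosed {u | F u = 0} := isClosed_eq hF continuous_const
  obtain ⟨U, hUo, hUd, hyU, hcov⟩ := exists_separating_opens (hKc.inter_left hY) hSne
    (fun y hy => ⟨hS y hy, fun j => (hR y hy j).le, (hL y hy).le⟩) hdist
  set O : Set (κ → ℝ) := {u | (∀ j, -R < u j) ∧ ∑ j, u j < L} with hO
  have hOo : IsOpen O := by
    refine IsOpen.inter ?_ (isOpen_lt (f := fun u : κ → ℝ => ∑ j, u j) (by fun_prop)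
      continuous_const)
    change IsOpen {u : κ → ℝ | ∀ j, -R < u j}
    simp only [ofPred_forall]
    exact isOpen_iInter_of_finite fun j => isOpen_lt continuous_const (continuous_apply j)
  have hOK : O ⊆ K := fun u hu => ⟨fun j => (hu.1 j).le, hu.2.le⟩
  have hseg : ∀ y : S, ∃ p q : κ → ℝ, 0 < F p ∧ F q < 0 ∧ segment ℝ p q ⊆ U y ∩ O := by
    intro y
    obtain ⟨ε, hε, hball⟩ := Metric.isOpen_iff.1 ((hUo y).inter hOo) y
      ⟨hyU y, hR y y.2, hL y y.2⟩
    obtain ⟨p, hp, hpb⟩ := Metric.mem_closure_iff.1 (hpos y y.2) ε hε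
    obtain ⟨q, hq, hqb⟩ := Metric.mem_closure_iff.1 (hneg y y.2) ε hε
    refine ⟨p, q, hp, hq, ((convex_ball (y : κ → ℝ) ε).segment_subset ?_ ?_).trans hball⟩
    · rwa [Metric.mem_ball']
    · rwa [Metric.mem_ball']
  choose p q hp hq hpq using hseg
  obtain ⟨δ₁, hδ₁, hδ₁F⟩ : ∃ δ > 0, ∀ u ∈ K, u ∉ ⋃ y, U y → δ ≤ |F u| := by
    have hc : IsCompact (K \ ⋃ y, U y) := hKc.diff (isOpen_iUnion hUo)
    rcases (K \ ⋃ y, U y).eq_empty_or_nonempty with h | h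
    · exact ⟨1, one_pos, fun u hu hu' => absurd (show u ∈ K \ ⋃ y, U y from ⟨hu, hu'⟩) (by simp [h])⟩
    · obtain ⟨u₀, hu₀, hmin⟩ := hc.exists_isMinOn h hF.abs.continuousOn
      refine ⟨|F u₀|, abs_pos.2 fun h0 => hu₀.2 (hcov ⟨h0, hu₀.1⟩), fun u hu hu' => ?_⟩
      exact hmin ⟨hu, hu'⟩
  obtain ⟨δ, hδ, hδ₁', hδp, hδq⟩ : ∃ δ > 0, δ < δ₁ ∧ (∀ y, δ < F (p y)) ∧ ∀ y, δ < -F (q y) := by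
    have h : ∀ᶠ δ in 𝓝[>] (0 : ℝ), δ < δ₁ ∧ (∀ y, δ < F (p y)) ∧ ∀ y, δ < -F (q y) := by
      refine nhdsWithin_le_nhds ((gt_mem_nhds hδ₁).and ((Filter.eventually_all.2 fun y => ?_).and
        (Filter.eventually_all.2 fun y => ?_)))
      · exact gt_mem_nhds (hp y)
      · exact gt_mem_nhds (neg_pos.2 (hq y))
    obtain ⟨δ, hδ, hδ0⟩ := (h.and self_mem_nhdsWithin).exists
    exact ⟨δ, hδ0, hδ⟩
  refine ⟨R, L, δ, hδ, fun G hG hGF => ?_⟩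
  have hmin : ∀ y : S, ∃ m ∈ U y, G m = 0 ∧ (∀ j, -R ≤ m j) ∧
        ∀ᶠ u in 𝓝 m, G u = 0 → (∀ j, -R ≤ u j) → ∑ j, m j ≤ ∑ j, u j := by
    intro y
    set A : Set (κ → ℝ) := {u | G u = 0 ∧ u ∈ K ∧ u ∈ U y} with hA
    have hAeq : A = (K ∩ {u | G u = 0}) \ ⋃ (y') (_ : y' ≠ y), U y' := by
      ext u
      simp only [hA, mem_ofPred_eq, Set.mem_sdiff, mem_inter_iff, mem_iUnion, not_exists]
      constructor
      · rintro ⟨h1, h2, h3⟩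
        exact ⟨⟨h2, h1⟩, fun y' hy' h => Set.disjoint_left.1 (hUd y' y hy') h h3⟩
      · rintro ⟨⟨h2, h1⟩, h3⟩
        refine ⟨h1, h2, ?_⟩
        have hmem : u ∈ ⋃ y, U y := by
          by_contra hcon
          have h4 := hδ₁F u h2 hcon
          have h5 := hGF u h2
          rw [h1, zero_sub, abs_neg] at h5
          linarith
        obtain ⟨y', hy'⟩ := mem_iUnion.1 hmem
        by_cases h : y' = y
        · rwa [← h]
        · exact absurd hy' (h3 y' h)
    have hAc : IsCompact A := by
      rw [hAeq]
      exact (hKc.inter_right (isClosed_eq hG continuous_const)).diff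
        (isOpen_iUnion fun _ => isOpen_iUnion fun _ => hUo _)
    obtain ⟨w, hw, hw0⟩ : ∃ w ∈ segment ℝ (p y) (q y), G w = 0 := by
      have hconn : IsPreconnected (segment ℝ (p y) (q y)) := (convex_segment _ _).isPreconnected
      have hpK := hGF _ (hOK (hpq y (left_mem_segment ℝ _ _)).2)
      have hqK := hGF _ (hOK (hpq y (right_mem_segment ℝ _ _)).2)
      rw [abs_lt] at hpK hqK
      have h1 := hδp y
      have h2 := hδq y
      exact hconn.intermediate_value (right_mem_segment ℝ _ _) (left_mem_segment ℝ _ _)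
        hG.continuousOn ⟨by linarith, by linarith⟩
    have hwO := hpq y hw
    obtain ⟨m, hm, hmmin⟩ := hAc.exists_isMinOn ⟨w, hw0, hOK hwO.2, hwO.1⟩
      (f := fun u : κ → ℝ => ∑ j, u j) (by fun_prop)
    refine ⟨m, hm.2.2, hm.1, hm.2.1.1, ?_⟩
    have hmL : ∑ j, m j < L :=
      lt_of_le_of_lt (hmmin (show w ∈ A from ⟨hw0, hOK hwO.2, hwO.1⟩)) hwO.2.2
    filter_upwards [(hUo y).mem_nhds hm.2.2,
      (isOpen_lt (f := fun u : κ → ℝ => ∑ j, u j) (by fun_prop) continuous_const).mem_nhds hmL]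
      with u hu huL hGu huR
    exact hmmin (show u ∈ A from ⟨hGu, ⟨huR, le_of_lt huL⟩, hu⟩)
  choose m hmU hm using hmin
  refine ⟨fun y => if h : y ∈ S then m ⟨y, h⟩ else 0, fun y hy y' hy' h => ?_, fun y hy => ?_⟩
  · have hy : y ∈ S := hy
    have hy' : y' ∈ S := hy'
    simp only [hy, hy', dif_pos] at h
    by_contra hne
    have h2 := hmU ⟨y', hy'⟩
    rw [← h] at h2
    exact Set.disjoint_left.1 (hUd ⟨y, hy⟩ ⟨y', hy'⟩ (by simpa using hne)) (hmU _) h2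
  · simp only [hy, dif_pos]
    exact hm ⟨y, hy⟩

/-- At a local minimizer of `∑ u` on a hypersurface in an orthant, the partial derivatives in the
free directions agree. -/
lemma partial_eq_of_local_minimizer [DecidableEq κ] {G : (κ → ℝ) → ℝ} {G' : (κ → ℝ) →L[ℝ] ℝ}
    {m : κ → ℝ} {R : ℝ} (hG : HasStrictFDerivAt G G' m) (h0 : G m = 0) (hR : ∀ j, -R ≤ m j)
    (hmin : ∀ᶠ u in 𝓝 m, G u = 0 → (∀ j, -R ≤ u j) → ∑ j, m j ≤ ∑ j, u j)
    {i i' : κ} (hi : -R < m i) (hi' : -R < m i') :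
    G' (Pi.single i 1) = G' (Pi.single i' 1) := by
  let P : (κ → ℝ) →L[ℝ] (κ → ℝ) := ContinuousLinearMap.pi fun j =>
    if -R < m j then ContinuousLinearMap.proj j else 0
  have hP : ∀ v j, P v j = if -R < m j then v j else 0 := by
    intro v j; simp only [P, ContinuousLinearMap.pi_apply]; split_ifs <;> simp
  let σ : (κ → ℝ) →L[ℝ] ℝ := ∑ j, ContinuousLinearMap.proj j
  have hσ : ∀ v, σ v = ∑ j, v j := by intro v; simp [σ]
  have hshift : HasStrictFDerivAt (fun v => m + P v) P 0 := P.hasStrictFDerivAt.const_add m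
  have hf : HasStrictFDerivAt (fun v => G (m + P v)) (G'.comp P) 0 :=
    HasStrictFDerivAt.comp (g := G) (f := fun v => m + P v) 0 (by simpa using hG) hshift
  have hφ : HasStrictFDerivAt (fun v => σ (P v)) (σ.comp P) 0 := (σ.comp P).hasStrictFDerivAt
  have hcont : Tendsto (fun v => m + P v) (𝓝 0) (𝓝 m) := by
    simpa using hshift.continuousAt.tendsto
  have hext : IsLocalExtrOn (fun v => σ (P v))
      {v | (fun v => G (m + P v)) v = (fun v => G (m + P v)) 0} 0 := by
    refine Or.inl ?_
    have h1 : ∀ᶠ v in 𝓝 (0 : κ → ℝ), ∀ j, -R < m j → -R < (m + P v) j := by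
      refine Filter.eventually_all.2 fun j => ?_
      by_cases hj : -R < m j
      · filter_upwards [((continuous_apply j).tendsto m).comp hcont |>.eventually
          (lt_mem_nhds hj)] with v hv _ using hv
      · exact Eventually.of_forall fun v h => absurd h hj
    filter_upwards [nhdsWithin_le_nhds (hcont.eventually hmin), nhdsWithin_le_nhds h1,
      self_mem_nhdsWithin] with v hv hv1 hv0
    have h2 : G (m + P v) = 0 := by simpa [h0] using hv0
    have h3 := hv h2 fun j => by
      by_cases hj : -R < m j
      · exact (hv1 j hj).le
      · simpa [hP, hj] using hR j
    simp only [Pi.add_apply, Finset.sum_add_distrib] at h3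
    simp only [map_zero, hσ, Pi.zero_apply, Finset.sum_const_zero]
    linarith
  obtain ⟨a, b, hab, h⟩ := hext.exists_multipliers_of_hasStrictFDerivAt_1d hf hφ
  have hPs : ∀ j, -R < m j → P (Pi.single j 1) = Pi.single j 1 := by
    intro j hj
    ext l
    rw [hP]
    by_cases hl : l = j
    · subst hl; simp [hj]
    · simp [hl]
  have key : ∀ j, -R < m j → a * G' (Pi.single j 1) + b = 0 := by
    intro j hj
    have := DFunLike.congr_fun h (Pi.single j 1)
    simpa [hPs j hj, hσ] using this
  have h1 := key i hi
  have h2 := key i' hi'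
  have ha : a ≠ 0 := by
    rintro rfl
    refine hab ?_
    simp only [zero_mul, zero_add] at h1
    simp [h1]
  have : a * G' (Pi.single i 1) = a * G' (Pi.single i' 1) := by linarith
  exact mul_left_cancel₀ ha this

end Minimizers

end

section

open Set Filter Topology MvPolynomial

section ExpSum

variable {κ η : Type*} [Fintype κ] [Fintype η]

/-- The exponential sum `c₀ + ∑ cᵢ exp(uᵢ) + ∑ dₗ exp((B u)ₗ)`. -/
noncomputable def expSum (d : η → ℝ) (B : η → κ → ℝ) (c : Option κ → ℝ) (u : κ → ℝ) : ℝ :=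
  c none + ∑ i, c (some i) * Real.exp (u i) + ∑ l, d l * Real.exp (∑ i, B l i * u i)

/-- The partial derivatives of `expSum`. -/
noncomputable def expSumGrad (d : η → ℝ) (B : η → κ → ℝ) (c : Option κ → ℝ) (u : κ → ℝ) (i : κ) :
    ℝ :=
  c (some i) * Real.exp (u i) + ∑ l, d l * B l i * Real.exp (∑ j, B l j * u j)

variable (d : η → ℝ) (B : η → κ → ℝ)

lemma continuous_uncurry_expSum :
    Continuous fun p : (Option κ → ℝ) × (κ → ℝ) => expSum d B p.1 p.2 := by
  unfold expSum; fun_prop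

lemma continuous_expSum (c : Option κ → ℝ) : Continuous (expSum d B c) :=
  (continuous_uncurry_expSum d B).comp (Continuous.prodMk_right c)

lemma hasStrictFDerivAt_expSum (c : Option κ → ℝ) (u : κ → ℝ) :
    HasStrictFDerivAt (expSum d B c)
      (∑ i, expSumGrad d B c u i • (ContinuousLinearMap.proj i : (κ → ℝ) →L[ℝ] ℝ)) u := by
  have h1 : ∀ i, HasStrictFDerivAt (fun u : κ → ℝ => u i)
      (ContinuousLinearMap.proj i : (κ → ℝ) →L[ℝ] ℝ) u := fun i =>
    (ContinuousLinearMap.proj i : (κ → ℝ) →L[ℝ] ℝ).hasStrictFDerivAt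
  have h2 := ((hasStrictFDerivAt_const (c none) u).fun_add (HasStrictFDerivAt.fun_sum
    (u := Finset.univ) fun i _ => (h1 i).exp.const_mul (c (some i)))).fun_add
      (HasStrictFDerivAt.fun_sum (u := Finset.univ) fun l _ =>
        (HasStrictFDerivAt.fun_sum (u := Finset.univ) fun i _ =>
          (h1 i).const_mul (B l i)).exp.const_mul (d l))
  refine HasStrictFDerivAt.congr_fderiv h2 ?_
  ext v
  simp only [expSumGrad, zero_add, add_apply, sum_apply, smul_apply,
    ContinuousLinearMap.proj_apply, smul_eq_mul, add_mul, Finset.sum_add_distrib,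
    Finset.mul_sum, Finset.sum_mul]
  congr 1
  · exact Finset.sum_congr rfl fun i _ => by ring
  · rw [Finset.sum_comm]
    exact Finset.sum_congr rfl fun i _ => Finset.sum_congr rfl fun l _ => by ring

/-- Nondegeneracy of `u` as a critical point of `∑ u` on the intersection of the hypersurface with
the face of free directions `I`. -/
def NondegenerateOn (c : Option κ → ℝ) (I : Finset κ) (u : κ → ℝ) : Prop :=
  ∀ (v : κ → ℝ) (μ : ℝ), (∀ j ∉ I, v j = 0) →
    (∀ i ∈ I, c (some i) * Real.exp (u i) * v i +
      ∑ l, d l * B l i * (Real.exp (∑ j, B l j * u j) * ∑ j, B l j * v j) = μ) →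
    ∑ i, c (some i) * (Real.exp (u i) * v i) +
      ∑ l, d l * (Real.exp (∑ j, B l j * u j) * ∑ j, B l j * v j) = 0 → v = 0

/-- For almost all coefficients, all critical points on all faces are nondegenerate. -/
lemma ae_nondegenerateOn (R : ℝ) :
    ∀ᵐ c ∂(MeasureTheory.volume : MeasureTheory.Measure (Option κ → ℝ)),
      ∀ (I : Finset κ) (u : κ → ℝ) (μ : ℝ), (∀ j ∉ I, u j = -R) →
        (∀ i ∈ I, expSumGrad d B c u i = μ) → expSum d B c u = 0 →
        NondegenerateOn d B c I u := by
  classical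
  rw [MeasureTheory.ae_all_iff]
  intro I
  let U : (Option κ → ℝ) → κ → ℝ := fun q j => if j ∈ I then q (some j) else -R
  let T : (Option κ → ℝ) → κ → ℝ := fun q i => if i ∈ I then
    Real.exp (-U q i) * (q none - ∑ l, d l * B l i * Real.exp (∑ j, B l j * U q j))
    else q (some i)
  let Θ : (Option κ → ℝ) → Option κ → ℝ := fun q => fun
    | some i => T q i
    | none => -(∑ i, T q i * Real.exp (U q i)) - ∑ l, d l * Real.exp (∑ j, B l j * U q j)
  have hU : ∀ j, Differentiable ℝ fun q => U q j := by
    intro j; simp only [U]; split_ifs <;> fun_prop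
  have hT : ∀ j, Differentiable ℝ fun q => T q j := by
    intro j; simp only [T]; split_ifs <;> fun_prop
  have hΘ : Differentiable ℝ Θ := by
    refine differentiable_pi.2 fun o => ?_
    rcases o with _ | i
    · simp only [Θ]; fun_prop
    · exact hT i
  have hnull := MeasureTheory.addHaar_image_eq_zero_of_det_fderivWithin_eq_zero
    (MeasureTheory.volume : MeasureTheory.Measure (Option κ → ℝ)) (f := Θ)
    (s := {q | (fderiv ℝ Θ q).det = 0}) (fun q _ => (hΘ q).hasFDerivAt.hasFDerivWithinAt)
    (fun q hq => hq)
  filter_upwards [MeasureTheory.measure_eq_zero_iff_ae_notMem.1 hnull] with c hc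
  intro u μ huI hμ hF v μ' hvI hvμ hvF
  let q : Option κ → ℝ := fun
    | none => μ
    | some j => if j ∈ I then u j else c (some j)
  let q' : Option κ → ℝ := fun
    | none => μ'
    | some j => v j
  have hUq : ∀ s : ℝ, U (q + s • q') = fun j => u j + s * v j := by
    intro s; ext j
    by_cases hj : j ∈ I
    · simp [U, q, q', hj]
    · simp [U, hj, huI j hj, hvI j hj]
  have hUq0 : U q = u := by have := hUq 0; simpa using this
  have hsub : ∀ i ∈ I, μ - ∑ l, d l * B l i * Real.exp (∑ j, B l j * u j) =
      c (some i) * Real.exp (u i) := by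
    intro i hi
    rw [← hμ i hi, expSumGrad]; ring
  have hTq : ∀ i, T q i = c (some i) := by
    intro i
    by_cases hi : i ∈ I
    · simp only [T, hi, if_true, hUq0]
      change Real.exp (-u i) * (μ - _) = _
      rw [hsub i hi, mul_left_comm, ← Real.exp_add]; simp
    · simp [T, hi, q]
  have hΘq : Θ q = c := by
    ext o
    rcases o with _ | i
    · simp only [Θ, hTq, hUq0]
      rw [expSum] at hF; linarith
    · exact hTq i
  have hdet : (fderiv ℝ Θ q).det ≠ 0 := fun h => hc ⟨q, h, hΘq⟩
  have hline : HasDerivAt (fun s : ℝ => q + s • q') q' 0 := by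
    have := ((hasDerivAt_id (0 : ℝ)).smul_const q').const_add q
    simpa using this
  have hcurve : HasDerivAt (fun s : ℝ => Θ (q + s • q')) (fderiv ℝ Θ q q') 0 := by
    have h1 : HasFDerivAt Θ (fderiv ℝ Θ q) (q + (0 : ℝ) • q') := by
      simpa using (hΘ q).hasFDerivAt
    exact h1.comp_hasDerivAt (0 : ℝ) hline
  have hu : ∀ j, HasDerivAt (fun s : ℝ => u j + s * v j) (v j) 0 := fun j => by
    simpa using ((hasDerivAt_id (0 : ℝ)).mul_const (v j)).const_add (u j)
  have hB : ∀ l, HasDerivAt (fun s : ℝ => Real.exp (∑ j, B l j * (u j + s * v j)))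
      (Real.exp (∑ j, B l j * u j) * ∑ j, B l j * v j) 0 := fun l => by
    simpa using (HasDerivAt.fun_sum (u := Finset.univ) fun j _ =>
      (hu j).const_mul (B l j)).exp
  have hTcurve : ∀ i, HasDerivAt (fun s : ℝ => T (q + s • q') i) 0 0 := by
    intro i
    by_cases hi : i ∈ I
    · simp only [T, hi, if_true, hUq]
      have h1 : HasDerivAt (fun s : ℝ => μ + s * μ') μ' 0 := by
        simpa using ((hasDerivAt_id (0 : ℝ)).mul_const μ').const_add μ
      have h2 := (hu i).fun_neg.exp.fun_mul (h1.fun_sub (HasDerivAt.fun_sum (u := Finset.univ)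
        fun l _ => (hB l).const_mul (d l * B l i)))
      refine h2.congr_deriv ?_
      simp only [zero_mul, add_zero]
      rw [hsub i hi, ← hvμ i hi]
      ring
    · simp only [T, hi, if_false]
      simpa [q', hvI i hi, q, hi] using hasDerivAt_const (0 : ℝ) (c (some i))
  have hzero : fderiv ℝ Θ q q' = 0 := by
    have hpi := hasDerivAt_pi.1 hcurve
    ext o
    rcases o with _ | i
    · refine (hpi none).unique ?_
      simp only [Θ, hUq]
      have h2 := (HasDerivAt.fun_sum (u := Finset.univ) fun i _ =>
        (hTcurve i).fun_mul (hu i).exp).fun_neg.fun_sub (HasDerivAt.fun_sum (u := Finset.univ)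
          fun l _ => (hB l).const_mul (d l))
      refine h2.congr_deriv ?_
      simp only [zero_mul, add_zero, zero_smul, zero_add, hTq, Pi.zero_apply]
      linarith
    · exact (hpi (some i)).unique (hTcurve i)
  have hinj : Function.Injective (fderiv ℝ Θ q) := by
    rw [ContinuousLinearMap.det, ← isUnit_iff_ne_zero, ← LinearMap.isUnit_iff_isUnit_det,
      LinearMap.isUnit_iff_ker_eq_bot] at hdet
    exact LinearMap.ker_eq_bot.1 hdet
  have hq' : q' = 0 := hinj (by rw [hzero, map_zero])
  ext j
  exact congrFun hq' (some j)

end ExpSum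

namespace ExpEqn

section FaceSystem

variable {κ η : Type*} [Fintype κ] [Fintype η] [DecidableEq κ] [DecidableEq η]

/-- The polynomial `a + ∑ w b * X b`. -/
noncomputable def affinePoly {ι : Type*} [Fintype ι] (a : ℝ) (w : ι → ℝ) : MvPolynomial ι ℝ :=
  C a + ∑ b, C (w b) * X b

lemma totalDegree_affinePoly_le {ι : Type*} [Fintype ι] (a : ℝ) (w : ι → ℝ) :
    (affinePoly a w).totalDegree ≤ 1 := by
  refine (totalDegree_add _ _).trans (max_le (by simp) ?_)
  exact totalDegree_finsetSum_le fun b _ => (totalDegree_mul _ _).trans (by simp)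

lemma val_affinePoly {ι : Type*} [Fintype ι] (a : ℝ) (w t : ι → ℝ) :
    (poly (affinePoly a w)).val t = a + ∑ b, w b * Real.exp (t b) := by
  simp [val, affinePoly]

lemma deriv_affinePoly {ι : Type*} [Fintype ι] [DecidableEq ι] (a : ℝ) (w t v : ι → ℝ) :
    (poly (affinePoly a w)).deriv t v = ∑ b, w b * Real.exp (t b) * v b := by
  simp only [deriv_apply, grad, affinePoly]
  refine Finset.sum_congr rfl fun b _ => ?_
  have : ∀ x, pderiv b (C (w x) * X x : MvPolynomial ι ℝ) = if x = b then C (w b) else 0 := by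
    intro x
    by_cases h : x = b
    · subst h; simp
    · simp [h, pderiv_X_of_ne (R := ℝ) h]
  simp only [map_add, pderiv_C, zero_add, map_sum, this, Finset.sum_ite_eq',
    Finset.mem_univ, if_true, map_mul, eval_X, eval_C]
  ring

variable (d : η → ℝ) (B : η → κ → ℝ) (c : Option κ → ℝ) (R : ℝ)

/-- The coefficients of the `i`-th partial derivative of an exponential sum. -/
def gradCoeff (i : κ) : κ ⊕ η → ℝ := Sum.elim (Pi.single i (c (some i))) fun l => d l * B l i

/-- The system satisfied by the critical points of `∑ u` on the face with free directions `I`. -/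
noncomputable def faceSystem (I : Finset κ) (i₀ : κ) : κ ⊕ η → ExpEqn (κ ⊕ η)
  | .inl j => if j ∈ I then
      if j = i₀ then poly (affinePoly (c none) (Sum.elim (fun i => c (some i)) d))
      else poly (affinePoly 0 (gradCoeff d B c j - gradCoeff d B c i₀))
    else coord (.inl j) (-R)
  | .inr l => lin (Sum.elim (fun i => -B l i) (Pi.single l 1)) 0

lemma mem_regularZeros_faceSystem {I : Finset κ} {i₀ : κ} (hi₀ : I.Nonempty → i₀ ∈ I) {u : κ → ℝ}
    (huI : ∀ j ∉ I, u j = -R) (hμ : ∀ i ∈ I, expSumGrad d B c u i = expSumGrad d B c u i₀)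
    (hF : expSum d B c u = 0) (hN : NondegenerateOn d B c I u) :
    Sum.elim u (fun l => ∑ i, B l i * u i) ∈ regularZeros (faceSystem d B c R I i₀) := by
  constructor
  · ext a
    rcases a with j | l
    · simp only [map, faceSystem]
      split_ifs with hj hj0
      · rw [val_affinePoly]
        simpa [expSum, add_assoc] using hF
      · rw [val_affinePoly]
        have := hμ j hj
        simp only [expSumGrad] at this
        simp [gradCoeff, sub_mul, Finset.sum_sub_distrib, Pi.single_apply]
        linarith
      · simp [val, huI j hj]
    · simp [map, faceSystem, val, Pi.single_apply]
  · rw [val_jac_ne_zero_iff]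
    intro v hv
    have hvr : ∀ l, v (.inr l) = ∑ i, B l i * v (.inl i) := by
      intro l
      have := hv (.inr l)
      simp [faceSystem, deriv_apply, grad, Pi.single_apply] at this
      linarith
    have hvI : ∀ j ∉ I, v (.inl j) = 0 := by
      intro j hj
      have := hv (.inl j)
      simpa [faceSystem, hj, deriv_apply, grad, apply_ite (eval _)] using this
    have hvl : (fun i => v (.inl i)) = 0 := by
      rcases I.eq_empty_or_nonempty with rfl | hI
      · ext j; exact hvI j (by simp)
      · refine hN _ (c (some i₀) * Real.exp (u i₀) * v (.inl i₀) + ∑ l, d l * B l i₀ *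
          (Real.exp (∑ j, B l j * u j) * ∑ j, B l j * v (.inl j))) hvI (fun i hi => ?_) ?_
        · by_cases h : i = i₀
          · rw [h]
          have := hv (.inl i)
          simp only [faceSystem, hi, if_true, h, if_false, deriv_affinePoly] at this
          simp [gradCoeff, sub_mul, Finset.sum_sub_distrib, Pi.single_apply, hvr] at this
          simp only [mul_assoc] at this ⊢
          linarith
        · have := hv (.inl i₀)
          simp only [faceSystem, hi₀ hI, if_true, deriv_affinePoly] at this
          simpa [hvr, mul_assoc] using this
    ext a
    rcases a with j | l
    · exact congrFun hvl j
    · rw [hvr]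
      exact Finset.sum_eq_zero fun i _ => by rw [show v (.inl i) = 0 from congrFun hvl i, mul_zero]

lemma card_le_rolleBound_faceSystem (I : Finset κ) (i₀ : κ) (Z : Finset (κ ⊕ η → ℝ))
    (hZ : (Z : Set (κ ⊕ η → ℝ)) ⊆ regularZeros (faceSystem d B c R I i₀)) :
    Z.card ≤ rolleBound (Fintype.card κ + Fintype.card η) (Fintype.card η) (Fintype.card κ) := by
  have hl : {a | (faceSystem d B c R I i₀ a).IsLin} = range Sum.inr := by
    ext a
    rcases a with j | l
    · simp only [mem_ofPred_eq, faceSystem]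
      split_ifs <;> simp [IsLin]
    · simp [faceSystem, IsLin]
  have hlin : {a | (faceSystem d B c R I i₀ a).IsLin}.ncard = Fintype.card η := by
    rw [hl, ← image_univ, ncard_image_of_injective _ Sum.inr_injective, ncard_univ,
      Nat.card_eq_fintype_card]
  have hdeg : ∑ a, (faceSystem d B c R I i₀ a).gradDegree ≤ Fintype.card κ := by
    rw [Fintype.sum_sum_type]
    simp only [faceSystem, gradDegree, Finset.sum_const_zero, add_zero]
    refine (Finset.sum_le_sum (g := fun _ => 1) fun j _ => ?_).trans (by simp)
    split_ifs <;> simp [totalDegree_affinePoly_le]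
  have hbez : ∏ a, (faceSystem d B c R I i₀ a).bezoutDegree ≤ 1 := by
    refine Finset.prod_le_one' fun a _ => ?_
    rcases a with j | l
    · simp only [faceSystem]
      split_ifs <;> simp [bezoutDegree, totalDegree_affinePoly_le]
    · simp [faceSystem, bezoutDegree]
  have := card_le_rolleBound _ _ _ hlin hdeg Z hZ
  rw [Fintype.card_sum] at this
  exact this.trans ((Nat.mul_le_mul_left _ hbez).trans (by simp))

end FaceSystem

end ExpEqn

open ExpEqn in
/-- The number of connected components of the zero set of an exponential sum along which it changes
sign. -/
theorem card_le_two_pow_mul_rolleBound {κ η : Type*} [Fintype κ] [Fintype η] [Nonempty κ]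
    (d : η → ℝ) (B : η → κ → ℝ) (c : Option κ → ℝ) (S : Finset (κ → ℝ))
    (hS : ∀ y ∈ S, expSum d B c y = 0) (hpos : ∀ y ∈ S, y ∈ closure {u | 0 < expSum d B c u})
    (hneg : ∀ y ∈ S, y ∈ closure {u | expSum d B c u < 0})
    (hdist : InjOn (connectedComponentIn {u | expSum d B c u = 0}) S) :
    S.card ≤ 2 ^ Fintype.card κ *
      rolleBound (Fintype.card κ + Fintype.card η) (Fintype.card η) (Fintype.card κ) := by
  classical
  obtain ⟨R, L, δ, hδ, hmin⟩ := exists_local_minimizers (continuous_expSum d B c) S hS hpos hneg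
    hdist
  have hnear : ∀ᶠ c' in 𝓝 c, ∀ u ∈ bigSimplex κ R L, |expSum d B c' u - expSum d B c u| < δ := by
    refine (isCompact_bigSimplex R L).eventually_forall_of_forall_eventually fun u _ => ?_
    have hcont : Continuous fun p : (Option κ → ℝ) × (κ → ℝ) =>
        |expSum d B p.1 p.2 - expSum d B c p.2| :=
      ((continuous_uncurry_expSum d B).sub ((continuous_expSum d B c).comp continuous_snd)).abs
    exact hcont.continuousAt.eventually_lt continuousAt_const (by simpa using hδ)
  obtain ⟨N, hN, hNo, hcN⟩ := eventually_nhds_iff.1 hnear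
  obtain ⟨c', hc'N, hc'⟩ := (MeasureTheory.Measure.dense_of_ae
    (ae_nondegenerateOn d B R)).inter_open_nonempty N hNo ⟨c, hcN⟩
  obtain ⟨m, hminj, hm⟩ := hmin _ (continuous_expSum d B c') (hN c' hc'N)
  let I : (κ → ℝ) → Finset κ := fun y => Finset.univ.filter fun j => -R < m y j
  let i₀ : Finset κ → κ := fun I => Classical.epsilon (· ∈ I)
  have hi₀ : ∀ I : Finset κ, I.Nonempty → i₀ I ∈ I := fun I hI => Classical.epsilon_spec hI
  have hreg : ∀ y ∈ S, Sum.elim (m y) (fun l => ∑ i, B l i * m y i) ∈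
      regularZeros (faceSystem d B c' R (I y) (i₀ (I y))) := by
    intro y hy
    obtain ⟨h0, hR, hloc⟩ := hm y hy
    have huI : ∀ j ∉ I y, m y j = -R := by
      intro j hj
      simp only [I, Finset.mem_filter, Finset.mem_univ, true_and, not_lt] at hj
      exact le_antisymm hj (hR j)
    have hμ : ∀ i ∈ I y, expSumGrad d B c' (m y) i = expSumGrad d B c' (m y) (i₀ (I y)) := by
      intro i hi
      have := partial_eq_of_local_minimizer (hasStrictFDerivAt_expSum d B c' (m y)) h0 hR hloc
        (i := i) (i' := i₀ (I y)) (by simpa [I] using hi)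
        (by simpa [I] using hi₀ (I y) ⟨i, hi⟩)
      simpa [Pi.single_apply] using this
    exact mem_regularZeros_faceSystem d B c' R (hi₀ _) huI hμ h0 (hc' _ _ _ huI hμ h0)
  refine (Finset.card_le_mul_card_image (f := I) S (rolleBound (Fintype.card κ + Fintype.card η)
    (Fintype.card η) (Fintype.card κ)) fun J _ => ?_).trans ?_
  · have hinj : InjOn (fun y => (Sum.elim (m y) (fun l => ∑ i, B l i * m y i) : κ ⊕ η → ℝ))
        (S.filter fun y => I y = J) := by
      intro y hy y' hy' h
      refine hminj (Finset.mem_filter.1 hy).1 (Finset.mem_filter.1 hy').1 (funext fun j => ?_)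
      exact congrFun h (Sum.inl j)
    rw [← Finset.card_image_of_injOn hinj]
    refine card_le_rolleBound_faceSystem d B c' R J (i₀ J) _ ?_
    rw [Finset.coe_image]
    rintro _ ⟨y, hy, rfl⟩
    obtain ⟨hyS, rfl⟩ := Finset.mem_filter.1 hy
    exact hreg y hyS
  · rw [mul_comm]
    refine Nat.mul_le_mul_right _ ((Finset.card_le_univ _).trans ?_)
    simp

end

section

open Set Filter Topology


/-- An affinely spanning and affinely independent subset of a finite set, in coordinates. -/
lemma exists_affine_frame {V : Type*} [DecidableEq V] [AddCommGroup V] [Module ℝ V] {n k : ℕ} (A : Finset V)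
    (hA : A.card = n + k + 1)
    (hspan : Module.finrank ℝ (affineSpan ℝ (A : Set V)).direction = n) :
    ∃ (T : Finset V) (o : T), T ⊆ A ∧ Nat.card {x : T // x ≠ o} = n ∧
      Nat.card {a // a ∈ (A : Set V) \ T} = k ∧
      LinearIndependent ℝ (fun i : {x : T // x ≠ o} => (i : V) - o) ∧
      ∀ b ∈ A, ∃ β : {x : T // x ≠ o} → ℝ, ∑ i, β i • ((i : V) - o) = b - o := by
  obtain ⟨t, htA, htspan, hind⟩ := exists_affineIndependent ℝ V (A : Set V)
  obtain ⟨T, rfl⟩ := (A.finite_toSet.subset htA).exists_finset_coe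
  have hTA : T ⊆ A := by simpa using htA
  have hTne : T.Nonempty := by
    by_contra h
    rw [Finset.not_nonempty_iff_eq_empty] at h
    subst h
    have hempty : affineSpan ℝ (A : Set V) = ⊥ := by rw [← htspan]; simp
    rw [affineSpan_eq_bot] at hempty
    have : A = ∅ := by simpa using hempty
    simp [this] at hA
  have : Nonempty T := hTne.to_subtype
  set p : T → V := Subtype.val with hp
  have hind : AffineIndependent ℝ p := hind
  have hrange : range p = (T : Set V) := Subtype.range_coe
  have hcard : T.card = n + 1 := by
    have h := hind.finrank_vectorSpan_add_one
    rw [hrange, ← direction_affineSpan, htspan, hspan, Fintype.card_coe] at h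
    exact h.symm
  obtain ⟨o⟩ := this
  refine ⟨T, o, hTA, ?_, ?_, ?_, ?_⟩
  · rw [Nat.card_eq_fintype_card, Fintype.card_subtype_compl, Fintype.card_coe, hcard]; simp
  · rw [← Finset.coe_sdiff, Nat.card_eq_fintype_card]
    have : Fintype.card {a // a ∈ (↑(A \ T) : Set V)} = (A \ T).card := Fintype.card_coe _
    rw [this, Finset.card_sdiff_of_subset hTA]; omega
  · exact (affineIndependent_iff_linearIndependent_vsub ℝ p o).1 hind
  · intro b hb
    have h1 : b -ᵥ (o : V) ∈ (affineSpan ℝ (range p)).direction := by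
      rw [hrange]
      refine AffineSubspace.vsub_mem_direction ?_ (subset_affineSpan ℝ _ o.2)
      rw [htspan]
      exact subset_affineSpan ℝ _ hb
    rw [direction_affineSpan, vectorSpan_range_eq_span_range_vsub_right_ne ℝ p o,
      Submodule.mem_span_range_iff_exists_fun] at h1
    exact h1

lemma mem_closure_pos_of_fderiv_ne_zero {E : Type*} [NormedAddCommGroup E] [NormedSpace ℝ E]
    {f : E → ℝ} {x : E} (h0 : f x = 0) (hd : fderiv ℝ f x ≠ 0) : x ∈ closure {y | 0 < f y} := by
  by_contra h
  rw [mem_closure_iff_frequently, not_frequently] at h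
  refine hd (IsLocalMax.fderiv_eq_zero ?_)
  filter_upwards [h] with y hy
  rw [h0]; exact not_lt.1 hy

lemma mem_closure_neg_of_fderiv_ne_zero {E : Type*} [NormedAddCommGroup E] [NormedSpace ℝ E]
    {f : E → ℝ} {x : E} (h0 : f x = 0) (hd : fderiv ℝ f x ≠ 0) : x ∈ closure {y | f y < 0} := by
  by_contra h
  rw [mem_closure_iff_frequently, not_frequently] at h
  refine hd (IsLocalMin.fderiv_eq_zero ?_)
  filter_upwards [h] with y hy
  rw [h0]; exact not_lt.1 hy

/-- A signomial is, up to a positive monomial and a linear change of logarithmic coordinates,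
an exponential sum in as many variables as the dimension of its exponent set. -/
lemma exists_expSum_eq {N n k : ℕ} (A : Finset (Fin N → ℝ)) (hA : A.card = n + k + 1)
    (hspan : Module.finrank ℝ (affineSpan ℝ (A : Set (Fin N → ℝ))).direction = n)
    (c : (Fin N → ℝ) → ℝ) :
    ∃ (κ η : Type) (_ : Fintype κ) (_ : Fintype η), Fintype.card κ = n ∧ Fintype.card η = k ∧
      ∃ (d : η → ℝ) (B : η → κ → ℝ) (c' : Option κ → ℝ) (L : (Fin N → ℝ) →ₗ[ℝ] κ → ℝ)
        (o : Fin N → ℝ), Function.Surjective L ∧ ∀ v : Fin N → ℝ,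
        ∑ a ∈ A, c a * ∏ i, Real.exp (v i) ^ a i =
          Real.exp (∑ i, o i * v i) * expSum d B c' (L v) := by
  classical
  obtain ⟨T, o, hTA, hκ, hη, hlin, hβ⟩ := exists_affine_frame A hA hspan
  rw [← Finset.coe_sdiff] at hη
  choose! β hβ using hβ
  let M : Matrix {x : T // x ≠ o} (Fin N) ℝ := Matrix.of fun i => (i : Fin N → ℝ) - o
  have hM : M.rank = Fintype.card {x : T // x ≠ o} := LinearIndependent.rank_matrix hlin
  refine ⟨{x : T // x ≠ o}, {a // a ∈ A \ T}, inferInstance, inferInstance, ?_, ?_,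
    fun l => c l, fun l => β l, fun j => j.elim (c o) fun i => c i, M.mulVecLin, o, ?_, ?_⟩
  · rw [← hκ, Nat.card_eq_fintype_card]
  · rw [← hη, ← Nat.card_eq_fintype_card]; rfl
  · refine LinearMap.range_eq_top.1 (Submodule.eq_top_of_finrank_eq ?_)
    rw [Module.finrank_fintype_fun_eq_card, ← hM]; rfl
  · intro v
    have hprod : ∀ a : Fin N → ℝ, ∏ i, Real.exp (v i) ^ a i = Real.exp (∑ i, a i * v i) := by
      intro a
      rw [Real.exp_sum]
      exact Finset.prod_congr rfl fun i _ => by rw [← Real.exp_mul, mul_comm]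
    have hL : ∀ i, M.mulVecLin v i = ∑ j, ((i : Fin N → ℝ) j - (o : Fin N → ℝ) j) * v j := by
      intro i
      simp [M, Matrix.mulVec, dotProduct]
    have hsplit : ∀ a : Fin N → ℝ, ∑ i, a i * v i =
        ∑ i, (o : Fin N → ℝ) i * v i + ∑ i, (a i - (o : Fin N → ℝ) i) * v i := by
      intro a
      rw [← Finset.sum_add_distrib]
      exact Finset.sum_congr rfl fun i _ => by ring
    have hBL : ∀ l ∈ A, ∑ i, β l i * M.mulVecLin v i =
        ∑ j, (l j - (o : Fin N → ℝ) j) * v j := by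
      intro l hl
      have h1 : ∀ j, l j - (o : Fin N → ℝ) j = ∑ i, β l i * (((i : T) : Fin N → ℝ) j -
          (o : Fin N → ℝ) j) := by
        intro j
        have := congrFun (hβ l hl) j
        simpa using this.symm
      simp only [hL, h1, Finset.mul_sum, Finset.sum_mul]
      rw [Finset.sum_comm]
      exact Finset.sum_congr rfl fun j _ => Finset.sum_congr rfl fun i _ => by ring
    have hterm : ∀ a : Fin N → ℝ, c a * Real.exp (∑ i, a i * v i) =
        Real.exp (∑ i, (o : Fin N → ℝ) i * v i) *
          (c a * Real.exp (∑ i, (a i - (o : Fin N → ℝ) i) * v i)) := by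
      intro a
      rw [hsplit a, Real.exp_add]; ring
    simp only [hprod, hterm]
    rw [← Finset.mul_sum]
    congr 1
    rw [← Finset.sum_sdiff hTA, add_comm, ← Finset.sum_coe_sort T,
      ← Finset.sum_coe_sort (A \ T), Fintype.sum_eq_add_sum_subtype_ne _ o, expSum]
    congr 1
    · refine congrArg₂ (· + ·) (by simp) (Finset.sum_congr rfl fun i _ => ?_)
      rw [hL]; rfl
    · refine Finset.sum_congr rfl fun l _ => ?_
      rw [hBL l (Finset.mem_sdiff.1 l.2).1]

/-- The connected components of a smooth signomial hypersurface are at most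
`2 ^ n * rolleBound (n + k) k n` in number. -/
theorem components_finite_and_ncard_le {N n k : ℕ} (hn : 1 ≤ n)
    (A : Finset (Fin N → ℝ)) (hA : A.card = n + k + 1)
    (hspan : Module.finrank ℝ (affineSpan ℝ (A : Set (Fin N → ℝ))).direction = n)
    (c : (Fin N → ℝ) → ℝ) (f : (Fin N → ℝ) → ℝ)
    (hf : ∀ x : Fin N → ℝ, f x = ∑ a ∈ A, c a * ∏ i, (x i) ^ (a i))
    (X : Set (Fin N → ℝ)) (hX : X = {x | (∀ i, 0 < x i) ∧ f x = 0})
    (hsmooth : ∀ x ∈ X, fderiv ℝ f x ≠ 0) :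
    (components X).Finite ∧ (components X).ncard ≤ 2 ^ n * ExpEqn.rolleBound (n + k) k n := by
  classical
  obtain ⟨κ, η, _, _, hκ, hη, d, B, c', L, o, hL, hfL⟩ := exists_expSum_eq A hA hspan c
  have : Nonempty κ := Fintype.card_pos_iff.1 (by omega)
  set F := expSum d B c' with hF
  set Λ : (Fin N → ℝ) → κ → ℝ := fun x => L fun i => Real.log (x i) with hΛ
  have hfΛ : ∀ x : Fin N → ℝ, (∀ i, 0 < x i) →
      f x = Real.exp (∑ i, o i * Real.log (x i)) * F (Λ x) := by
    intro x hx
    rw [hf, ← hfL]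
    simp only [Real.exp_log (hx _)]
  have hXF : ∀ x, x ∈ X ↔ (∀ i, 0 < x i) ∧ F (Λ x) = 0 := by
    intro x
    rw [hX, mem_ofPred_eq]
    refine and_congr_right fun hx => ?_
    rw [hfΛ x hx]
    simp [Real.exp_ne_zero]
  have hLc : Continuous L := L.continuous_of_finiteDimensional
  have hpos_nhds : ∀ x ∈ X, ∀ᶠ x' in 𝓝 x, ∀ i, 0 < x' i := by
    intro x hx
    exact Filter.eventually_all.2 fun i =>
      (continuous_apply i).continuousAt.eventually (lt_mem_nhds (((hXF x).1 hx).1 i))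
  have hΛc : ∀ x ∈ X, ContinuousAt Λ x := by
    intro x hx
    refine hLc.continuousAt.comp (continuousAt_pi.2 fun i => ?_)
    exact (continuous_apply i).continuousAt.log (((hXF x).1 hx).1 i).ne'
  have hclos : ∀ x ∈ X, Λ x ∈ closure {u | 0 < F u} ∧ Λ x ∈ closure {u | F u < 0} := by
    intro x hx
    have h0 : f x = 0 := by rw [hX] at hx; exact hx.2
    have h1 := mem_closure_pos_of_fderiv_ne_zero h0 (hsmooth x hx)
    have h2 := mem_closure_neg_of_fderiv_ne_zero h0 (hsmooth x hx)
    rw [mem_closure_iff_frequently] at h1 h2 ⊢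
    rw [mem_closure_iff_frequently]
    refine ⟨(hΛc x hx).tendsto.frequently
        ((h1.and_eventually (hpos_nhds x hx)).mono fun x' h => ?_),
      (hΛc x hx).tendsto.frequently
        ((h2.and_eventually (hpos_nhds x hx)).mono fun x' h => ?_)⟩
    · have := h.1
      rw [mem_ofPred_eq, hfΛ x' h.2] at this
      exact pos_of_mul_pos_right this (Real.exp_pos _).le
    · have := h.1
      rw [mem_ofPred_eq, hfΛ x' h.2] at this
      exact neg_of_mul_neg_right this (Real.exp_pos _).le
  have hcomp : ∀ x ∈ X, ∀ x' ∈ X, connectedComponentIn {u | F u = 0} (Λ x) =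
      connectedComponentIn {u | F u = 0} (Λ x') →
      connectedComponentIn X x = connectedComponentIn X x' := by
    intro x hx x' hx' h
    obtain ⟨σ, hσ⟩ := L.exists_rightInverse_of_surjective (LinearMap.range_eq_top.2 hL)
    have hσ : ∀ u, L (σ u) = u := fun u => LinearMap.congr_fun hσ u
    have hσc : Continuous σ := σ.continuous_of_finiteDimensional
    let E : (κ → ℝ) × (Fin N → ℝ) → Fin N → ℝ := fun p i => Real.exp (σ p.1 i + p.2 i)
    have hEc : Continuous E := continuous_pi fun i => Real.continuous_exp.comp
      (((continuous_apply i).comp (hσc.comp continuous_fst)).add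
        ((continuous_apply i).comp continuous_snd))
    set D := connectedComponentIn {u | F u = 0} (Λ x) with hD
    have hpre : IsPreconnected (E '' (D ×ˢ (LinearMap.ker L : Set (Fin N → ℝ)))) :=
      (isPreconnected_connectedComponentIn.prod
        (LinearMap.ker L).convex.isPreconnected).image _ hEc.continuousOn
    have hsub : E '' (D ×ˢ (LinearMap.ker L : Set (Fin N → ℝ))) ⊆ X := by
      rintro _ ⟨⟨u, w⟩, ⟨hu, hw⟩, rfl⟩
      rw [hXF]
      refine ⟨fun i => Real.exp_pos _, ?_⟩
      have hw : L w = 0 := hw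
      have : Λ (E (u, w)) = u := by
        simp only [hΛ, E, Real.log_exp]
        change L (σ u + w) = u
        rw [map_add, hσ, hw, add_zero]
      rw [this]
      exact connectedComponentIn_subset {u | F u = 0} (Λ x) hu
    have hmem : ∀ z ∈ X, Λ z ∈ D → z ∈ E '' (D ×ˢ (LinearMap.ker L : Set (Fin N → ℝ))) := by
      intro z hz hzD
      refine ⟨(Λ z, (fun i => Real.log (z i)) - σ (Λ z)), ⟨hzD, ?_⟩, ?_⟩
      · change L _ = 0
        rw [map_sub, hσ, sub_self]
      · ext i
        simp [E, Real.exp_log (((hXF z).1 hz).1 i)]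
    have hxD : Λ x ∈ D := mem_connectedComponentIn ((hXF x).1 hx).2
    have hxD' : Λ x' ∈ D := h ▸ mem_connectedComponentIn ((hXF x').1 hx').2
    exact connectedComponentIn_eq
      (hpre.subset_connectedComponentIn (hmem x hx hxD) hsub (hmem x' hx' hxD'))
  have hbound : ∀ S : Finset (Set (Fin N → ℝ)), (S : Set (Set (Fin N → ℝ))) ⊆ components X →
      S.card ≤ 2 ^ n * ExpEqn.rolleBound (n + k) k n := by
    intro S hS
    have hS' : ∀ C ∈ S, ∃ x ∈ X, C = connectedComponentIn X x := fun C hC => hS hC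
    choose! x hxX hxC using hS'
    have hinj : ∀ C ∈ S, ∀ C' ∈ S, connectedComponentIn {u | F u = 0} (Λ (x C)) =
        connectedComponentIn {u | F u = 0} (Λ (x C')) → C = C' := by
      intro C hC C' hC' h
      rw [hxC C hC, hxC C' hC']
      exact hcomp _ (hxX C hC) _ (hxX C' hC') h
    have hcard := card_le_two_pow_mul_rolleBound d B c' (S.image fun C => Λ (x C))
      (by simpa using fun C hC => ((hXF _).1 (hxX C hC)).2)
      (by simpa using fun C hC => (hclos _ (hxX C hC)).1)
      (by simpa using fun C hC => (hclos _ (hxX C hC)).2) (by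
        intro y hy y' hy' h
        simp only [Finset.coe_image, mem_image, Finset.mem_coe] at hy hy'
        obtain ⟨C, hC, rfl⟩ := hy
        obtain ⟨C', hC', rfl⟩ := hy'
        rw [hinj C hC C' hC' h])
    rwa [Finset.card_image_of_injOn fun C hC C' hC' h => hinj C hC C' hC' (congrArg _ h),
      hκ, hη] at hcard
  have hfin : (components X).Finite := by
    by_contra h
    obtain ⟨Y, hY, hYc⟩ := Set.Infinite.exists_subset_card_eq h
      (2 ^ n * ExpEqn.rolleBound (n + k) k n + 1)
    have := hbound Y hY
    omega
  refine ⟨hfin, ?_⟩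
  rw [ncard_eq_toFinset_card _ hfin]
  exact hbound _ (by simp)

end

section

namespace ExpEqn

lemma rolleBound_mul_le {n : ℕ} (hn : 1 ≤ n) (k j a : ℕ) :
    rolleBound (n + k) j (n * a) ≤ n ^ j * rolleBound (k + 1) j a := by
  induction j generalizing a with
  | zero => simp [rolleBound]
  | succ j ih =>
    have h : n + k ≤ n * (k + 1) := by nlinarith
    calc rolleBound (n + k) (j + 1) (n * a)
        = n * a * rolleBound (n + k) j (n * (2 * a)) + (n + k) * rolleBound (n + k) j (n * a) := by
          rw [rolleBound, mul_left_comm]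
      _ ≤ n * a * (n ^ j * rolleBound (k + 1) j (2 * a)) +
          n * (k + 1) * (n ^ j * rolleBound (k + 1) j a) := by
          gcongr <;> exact ih _
      _ = n ^ (j + 1) * rolleBound (k + 1) (j + 1) a := by rw [rolleBound]; ring

lemma rolleBound_le_prod (E j a : ℕ) :
    rolleBound E j a ≤ ∏ l ∈ Finset.range j, (a * 2 ^ l + E) := by
  induction j generalizing a with
  | zero => simp [rolleBound]
  | succ j ih =>
    have h1 : ∏ l ∈ Finset.range j, (2 * a * 2 ^ l + E) =
        ∏ l ∈ Finset.range j, (a * 2 ^ (l + 1) + E) :=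
      Finset.prod_congr rfl fun l _ => by ring
    have h2 : ∏ l ∈ Finset.range j, (a * 2 ^ l + E) ≤
        ∏ l ∈ Finset.range j, (a * 2 ^ (l + 1) + E) :=
      Finset.prod_le_prod' fun l _ => by gcongr <;> omega
    rw [rolleBound, Finset.prod_range_succ', mul_comm (Finset.prod _ _), pow_zero, mul_one, add_mul]
    refine add_le_add ?_ ?_
    · exact Nat.mul_le_mul_left _ (h1 ▸ ih (2 * a))
    · exact Nat.mul_le_mul_left _ ((ih a).trans h2)

lemma prod_one_add_div_two_pow_le {c : ℝ} (hc : 0 ≤ c) (m : ℕ) :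
    ∏ l ∈ Finset.range (m + 4), (1 + c / 2 ^ l) ≤
      (1 + c) * (1 + c / 2) * (1 + c / 4) * (1 + c / 8) *
        Real.exp (c / 8 - c / (8 * 2 ^ m)) := by
  induction m with
  | zero => norm_num [Finset.prod_range_succ]
  | succ m ih =>
    rw [show m + 1 + 4 = m + 4 + 1 by ring, Finset.prod_range_succ]
    have h1 : 1 + c / 2 ^ (m + 4) ≤ Real.exp (c / 2 ^ (m + 4)) := by
      rw [add_comm]; exact Real.add_one_le_exp _
    have h2 : c / 8 - c / (8 * 2 ^ (m + 1)) = c / 8 - c / (8 * 2 ^ m) + c / 2 ^ (m + 4) := by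
      have : (2 : ℝ) ^ m ≠ 0 := by positivity
      rw [pow_succ, pow_add]
      field_simp
      ring
    rw [h2, Real.exp_add, ← mul_assoc]
    exact mul_le_mul ih h1 (by positivity) (by positivity)

lemma quartic_mul_exp_le (m : ℕ) :
    (1 + ((m : ℝ) + 12)) * (1 + ((m : ℝ) + 12) / 2) * (1 + ((m : ℝ) + 12) / 4) *
      (1 + ((m : ℝ) + 12) / 8) * Real.exp (((m : ℝ) + 12) / 8) ≤ 259 / 100 * 2 ^ (m + 11) := by
  have he := Real.exp_one_lt_d9
  have he' := Real.exp_pos 1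
  induction m with
  | zero =>
    have h1 : Real.exp (12 / 8) ≤ 9 / 2 := by
      refine le_of_pow_le_pow_left₀ two_ne_zero (by norm_num) ?_
      rw [← Real.exp_nat_mul, show ((2 : ℕ) : ℝ) * (12 / 8) = (3 : ℕ) * 1 by norm_num,
        Real.exp_nat_mul]
      calc Real.exp 1 ^ 3 ≤ 2.7182818286 ^ 3 := by gcongr
        _ ≤ _ := by norm_num
    norm_num at h1 ⊢
    linarith
  | succ m ih =>
    have h1 : Real.exp (1 / 8) ≤ 5 / 4 := by
      refine le_of_pow_le_pow_left₀ (n := 8) (by norm_num) (by norm_num) ?_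
      rw [← Real.exp_nat_mul, show ((8 : ℕ) : ℝ) * (1 / 8) = 1 by norm_num]
      exact he.le.trans (by norm_num)
    have h2 : Real.exp ((((m + 1 : ℕ) : ℝ) + 12) / 8) =
        Real.exp (((m : ℝ) + 12) / 8) * Real.exp (1 / 8) := by
      rw [← Real.exp_add]; congr 1; push_cast; ring
    have hm : (0 : ℝ) ≤ m := m.cast_nonneg
    rw [h2, pow_succ]
    push_cast
    calc (1 + ((m : ℝ) + 1 + 12)) * (1 + ((m : ℝ) + 1 + 12) / 2) * (1 + ((m : ℝ) + 1 + 12) / 4) *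
          (1 + ((m : ℝ) + 1 + 12) / 8) * (Real.exp (((m : ℝ) + 12) / 8) * Real.exp (1 / 8))
        ≤ (14 / 13 * (1 + ((m : ℝ) + 12))) * (15 / 14 * (1 + ((m : ℝ) + 12) / 2)) *
          (17 / 16 * (1 + ((m : ℝ) + 12) / 4)) * (21 / 20 * (1 + ((m : ℝ) + 12) / 8)) *
          (Real.exp (((m : ℝ) + 12) / 8) * (5 / 4)) := by
          gcongr <;> linarith
      _ = (14 / 13 * (15 / 14) * (17 / 16) * (21 / 20) * (5 / 4)) *
          ((1 + ((m : ℝ) + 12)) * (1 + ((m : ℝ) + 12) / 2) * (1 + ((m : ℝ) + 12) / 4) *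
            (1 + ((m : ℝ) + 12) / 8) * Real.exp (((m : ℝ) + 12) / 8)) := by ring
      _ ≤ 2 * (259 / 100 * 2 ^ (m + 11)) := by
          refine mul_le_mul (by norm_num) ih (by positivity) (by norm_num)
      _ = 259 / 100 * (2 ^ (m + 11) * 2) := by ring

lemma two_pow_triangle (k : ℕ) :
    (2 : ℝ) ^ (k * (k + 1) / 2) = (∏ l ∈ Finset.range k, (2 : ℝ) ^ l) * 2 ^ k := by
  rw [Finset.prod_pow_eq_pow_sum, ← pow_add, ← Finset.sum_range_succ, Finset.sum_range_id,
    Nat.add_sub_cancel, mul_comm]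

lemma rolleBound_one_le (k : ℕ) :
    (rolleBound (k + 1) k 1 : ℝ) ≤ 259 / 100 * 2 ^ (k * (k + 1) / 2) := by
  rcases lt_or_ge k 11 with hk | hk
  · have : 100 * rolleBound (k + 1) k 1 ≤ 259 * 2 ^ (k * (k + 1) / 2) := by
      interval_cases k <;> decide
    have : (100 * rolleBound (k + 1) k 1 : ℝ) ≤ 259 * 2 ^ (k * (k + 1) / 2) := by
      exact_mod_cast this
    linarith
  · obtain ⟨m, rfl⟩ := Nat.exists_eq_add_of_le' hk
    have h1 : (rolleBound (m + 11 + 1) (m + 11) 1 : ℝ) ≤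
        ∏ l ∈ Finset.range (m + 11), ((2 : ℝ) ^ l + (m + 12)) := by
      have := rolleBound_le_prod (m + 11 + 1) (m + 11) 1
      simp only [one_mul, add_assoc] at this
      exact_mod_cast this
    have h2 : ∏ l ∈ Finset.range (m + 11), ((2 : ℝ) ^ l + (m + 12)) =
        (∏ l ∈ Finset.range (m + 11), (2 : ℝ) ^ l) *
          ∏ l ∈ Finset.range (m + 7 + 4), (1 + ((m : ℝ) + 12) / 2 ^ l) := by
      rw [← Finset.prod_mul_distrib]
      exact Finset.prod_congr rfl fun l _ => by field_simp
    have h3 := prod_one_add_div_two_pow_le (c := (m : ℝ) + 12) (by positivity) (m + 7)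
    have h4 : Real.exp (((m : ℝ) + 12) / 8 - ((m : ℝ) + 12) / (8 * 2 ^ (m + 7))) ≤
        Real.exp (((m : ℝ) + 12) / 8) :=
      Real.exp_le_exp.2 (sub_le_self _ (by positivity))
    rw [two_pow_triangle, mul_left_comm]
    refine h1.trans (h2.le.trans ?_)
    gcongr
    refine h3.trans (le_trans ?_ (quartic_mul_exp_le m))
    gcongr

theorem two_pow_mul_rolleBound_lt {n : ℕ} (hn : 1 ≤ n) (k : ℕ) :
    ((2 ^ n * rolleBound (n + k) k n : ℕ) : ℝ) <
      (Real.exp 1 ^ 2 + 3) / 4 * 2 ^ (k * (k + 1) / 2) * 2 ^ n * (n : ℝ) ^ (k + 1) := by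
  have hn' : (1 : ℝ) ≤ n := by exact_mod_cast hn
  have h1 : (rolleBound (n + k) k n : ℝ) ≤ n ^ k * rolleBound (k + 1) k 1 := by
    have := rolleBound_mul_le hn k k 1
    rw [mul_one] at this
    exact_mod_cast this
  have he : 259 / 100 < (Real.exp 1 ^ 2 + 3) / 4 := by
    have := Real.exp_one_gt_d9
    nlinarith
  push_cast
  calc (2 : ℝ) ^ n * rolleBound (n + k) k n
      ≤ 2 ^ n * (n ^ (k + 1) * (259 / 100 * 2 ^ (k * (k + 1) / 2))) := by
        refine mul_le_mul_of_nonneg_left (h1.trans ?_) (by positivity)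
        exact mul_le_mul (pow_le_pow_right₀ hn' (by omega)) (rolleBound_one_le k)
          (by positivity) (by positivity)
    _ = 259 / 100 * (2 ^ (k * (k + 1) / 2) * 2 ^ n * (n : ℝ) ^ (k + 1)) := by ring
    _ < (Real.exp 1 ^ 2 + 3) / 4 * (2 ^ (k * (k + 1) / 2) * 2 ^ n * (n : ℝ) ^ (k + 1)) := by
        gcongr
    _ = _ := by ring

end ExpEqn

end

/-- A smooth hypersurface in the positive orthant of `ℝ^N` defined by a
signomial with `n + k + 1` real exponent vectors whose affine span has dimension `n`
has fewer than `((e² + 3)/4) · 2^(k(k+1)/2) · 2^n · n^(k+1)` connected components;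
in particular, finitely many. -/
theorem signomial_hypersurface_bound (N n k : ℕ) (hn : 1 ≤ n)
    (A : Finset (Fin N → ℝ)) (hA : A.card = n + k + 1)
    (hspan : Module.finrank ℝ (affineSpan ℝ (A : Set (Fin N → ℝ))).direction = n)
    (c : (Fin N → ℝ) → ℝ) (hc : ∀ a ∈ A, c a ≠ 0)
    (f : (Fin N → ℝ) → ℝ)
    (hf : ∀ x : Fin N → ℝ, f x = ∑ a ∈ A, c a * ∏ i, (x i) ^ (a i))
    (X : Set (Fin N → ℝ))
    (hX : X = {x | (∀ i, 0 < x i) ∧ f x = 0})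
    (hsmooth : ∀ x ∈ X, fderiv ℝ f x ≠ 0) :
    (components X).Finite ∧
    ((components X).ncard : ℝ) <
      (Real.exp 1 ^ 2 + 3) / 4 * 2 ^ (k * (k + 1) / 2) * 2 ^ n * (n : ℝ) ^ (k + 1) := by
  obtain ⟨hfin, hle⟩ := components_finite_and_ncard_le hn A hA hspan c f hf X hX hsmooth
  exact ⟨hfin, (Nat.cast_le.2 hle).trans_lt (ExpEqn.two_pow_mul_rolleBound_lt hn k)⟩
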